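/- Let L/K satisfy condition (ram) with parameter n ≥ 1 and K unramified over ℚ_p. Put M_1 := O_L·m_1 = m_L^{p^n} (where m_1 is the maximal ideal of K_1, the fixed field of G^1) and V := O_L/M_1. For β ∈ O_L let f_β: O_L → k be x ↦ π^{−n}·Tr_{L/K}(βx) mod π, with values in the residue field k of K. Then f_β factors through V, f_β is identically zero if and only if β ∈ M_1, and the induced pairing V × V → k, (x,y) ↦ π^{−n}·Tr_{L/K}(xy) mod π, is a non-degenerate pairing of k-vector spaces. -/

import Mathlib

noncomputable section

open scoped Classical

/-- An additive `ℚ ∪ {∞}`-valued valuation on a field `A`, normalized by `v p = 1`.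
This models the `p`-adic valuation `v_p` on (an algebraic closure of) `ℚ_p`,
with the convention `v 0 = ∞`. -/
structure PadicValData (A : Type) [Field A] (p : ℕ) : Type where
  v : A → WithTop ℚ
  v_top_iff : ∀ x : A, v x = ⊤ ↔ x = 0
  v_mul : ∀ x y : A, v (x * y) = v x + v y
  v_min_le_add : ∀ x y : A, min (v x) (v y) ≤ v (x + y)
  v_coe_p : v (p : A) = 1

variable {p : ℕ} {A : Type} [Field A]

/-- `x ∈ F` is a uniformizer of the `p`-adic field `F` (embedded in `A` by `emb`):
its valuation is minimal among the positive valuations of elements of `F`. -/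
def IsUniformizer (vd : PadicValData A p) {F : Type} [Field F] (emb : F →+* A) (x : F) : Prop :=
  x ≠ 0 ∧ 0 < vd.v (emb x) ∧
    ∀ y : F, 0 < vd.v (emb y) → vd.v (emb x) ≤ vd.v (emb y)

/-- `y` belongs to the `j`-th power `m_F^j` of the maximal ideal of the ring of integers
`O_F` of `F` (embedded in `A` by `emb`): `y` is a multiple, by an element of `O_F`, of a
product of `j` elements of the maximal ideal `m_F`.  (For `j = 0` this says `y ∈ O_F`.) -/
def InMaxIdealPow (vd : PadicValData A p) {F : Type} [Field F] (emb : F →+* A) (j : ℕ)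
    (y : A) : Prop :=
  ∃ (u : F) (s : Fin j → F), 0 ≤ vd.v (emb u) ∧ (∀ k, 0 < vd.v (emb (s k))) ∧
    y = emb u * ∏ k, emb (s k)

/-- The lower-numbering ramification set
`G_i = {σ ∈ Gal(L/K) | ∀ x ∈ O_L, σ x - x ∈ m_L^{i+1}}` (with `G_i = G` for `i ≤ -1`). -/
def lowerRamSet (vd : PadicValData A p) (K L : Type) [Field K] [Field L] [Algebra K L]
    (emb : L →+* A) (i : ℤ) : Set (L ≃ₐ[K] L) :=
  {σ | ∀ x : L, 0 ≤ vd.v (emb x) →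
    InMaxIdealPow vd emb (i + 1).toNat (emb (σ x) - emb x)}

/-- The Herbrand function `φ_{L/K}(u) = ∫_0^u dt / (G_0 : G_t)`, where `G_t = G_{⌈t⌉}`. -/
noncomputable def herbrandPhi (vd : PadicValData A p) (K L : Type) [Field K] [Field L]
    [Algebra K L] (emb : L →+* A) (u : ℝ) : ℝ :=
  ∫ t in (0:ℝ)..u,
    (Nat.card ↥(lowerRamSet vd K L emb ⌈t⌉) : ℝ) /
      (Nat.card ↥(lowerRamSet vd K L emb 0) : ℝ)

/-- The Herbrand function `ψ_{L/K}`, the inverse of `φ_{L/K}`. -/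
noncomputable def herbrandPsi (vd : PadicValData A p) (K L : Type) [Field K] [Field L]
    [Algebra K L] (emb : L →+* A) (w : ℝ) : ℝ :=
  Function.invFun (herbrandPhi vd K L emb) w

/-- The upper-numbering ramification set `G^i = G_{ψ_{L/K}(i)}` of `Gal(L/K)`. -/
def upperRamSet (vd : PadicValData A p) (K L : Type) [Field K] [Field L] [Algebra K L]
    (emb : L →+* A) (i : ℤ) : Set (L ≃ₐ[K] L) :=
  lowerRamSet vd K L emb ⌈herbrandPsi vd K L emb (i : ℝ)⌉

/-- Condition (ram): the upper ramification groups of `L/K` satisfy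
`G = G^{-1} = G^0 ⊇ G^1 ⊋ G^2 ⊋ ⋯ ⊋ G^n ⊋ G^{n+1} = {1}`, with `G^i/G^{i+1}` of order `p`
for `1 ≤ i ≤ n` and `G^0/G^1` of order `p - 1`. -/
def RamCond (vd : PadicValData A p) (K L : Type) [Field K] [Field L] [Algebra K L]
    (emb : L →+* A) (n : ℕ) : Prop :=
  upperRamSet vd K L emb (-1) = Set.univ ∧
  upperRamSet vd K L emb 0 = Set.univ ∧
  (∀ i : ℤ, upperRamSet vd K L emb (i + 1) ⊆ upperRamSet vd K L emb i) ∧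
  Nat.card ↥(upperRamSet vd K L emb 0)
    = (p - 1) * Nat.card ↥(upperRamSet vd K L emb 1) ∧
  (∀ i : ℕ, 1 ≤ i → i ≤ n →
    Nat.card ↥(upperRamSet vd K L emb (i : ℤ))
      = p * Nat.card ↥(upperRamSet vd K L emb ((i : ℤ) + 1))) ∧
  upperRamSet vd K L emb ((n : ℤ) + 1) = {1}

/-- The local resolvent `⟨α|χ⟩ = ∑_{γ ∈ Gal(L/K)} χ(γ) γ(α)`, computed in `A`. -/
noncomputable def localResolvent (K L : Type) [Field K] [Field L] [Algebra K L]
    (emb : L →+* A) (χ : (L ≃ₐ[K] L) → A) (α : L) : A :=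
  ∑ᶠ γ : L ≃ₐ[K] L, χ γ * emb (γ α)

end


/-- A normalized discrete valuation on a field (value at zero irrelevant). -/
structure DV (L : Type) [Field L] : Type where
  w : L → ℤ
  mul : ∀ x y, x ≠ 0 → y ≠ 0 → w (x * y) = w x + w y
  add : ∀ x y, x ≠ 0 → y ≠ 0 → x + y ≠ 0 → min (w x) (w y) ≤ w (x + y)
  t : L
  t_ne : t ≠ 0
  w_t : w t = 1

namespace DV

variable {L : Type} [Field L] (D : DV L)

def M (j : ℤ) (x : L) : Prop := x = 0 ∨ j ≤ D.w x

variable {D}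

lemma M_zero (j : ℤ) : D.M j 0 := Or.inl rfl

lemma M_iff {j : ℤ} {x : L} (hx : x ≠ 0) : D.M j x ↔ j ≤ D.w x := by
  simp [M, hx]

lemma w_one : D.w 1 = 0 := by
  have := D.mul 1 1 one_ne_zero one_ne_zero
  rw [mul_one] at this
  omega

lemma w_neg (x : L) : D.w (-x) = D.w x := by
  by_cases hx : x = 0
  · simp [hx]
  have h1 : D.w (-1) = 0 := by
    have := D.mul (-1) (-1) (by simp) (by simp)
    rw [neg_mul_neg, mul_one, w_one] at this
    omega
  have := D.mul (-1) x (by simp) hx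
  rw [neg_one_mul, h1] at this
  omega

lemma w_inv {x : L} (hx : x ≠ 0) : D.w x⁻¹ = - D.w x := by
  have := D.mul x x⁻¹ hx (inv_ne_zero hx)
  rw [mul_inv_cancel₀ hx, w_one] at this
  omega

lemma w_div {x y : L} (hx : x ≠ 0) (hy : y ≠ 0) : D.w (x / y) = D.w x - D.w y := by
  rw [div_eq_mul_inv, D.mul x _ hx (inv_ne_zero hy), w_inv hy]; ring

lemma w_pow {x : L} (hx : x ≠ 0) (n : ℕ) : D.w (x ^ n) = n * D.w x := by
  induction n with
  | zero => simp [w_one]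
  | succ k ih => rw [pow_succ, D.mul _ _ (pow_ne_zero _ hx) hx, ih]; push_cast; ring

lemma w_zpow {x : L} (hx : x ≠ 0) (n : ℤ) : D.w (x ^ n) = n * D.w x := by
  cases n with
  | ofNat n => simpa using w_pow hx n
  | negSucc n =>
    rw [zpow_negSucc, w_inv (pow_ne_zero _ hx), w_pow hx, Int.negSucc_eq]; push_cast; ring

lemma w_prod {ι : Type*} (s : Finset ι) (f : ι → L) (hf : ∀ i ∈ s, f i ≠ 0) :
    D.w (∏ i ∈ s, f i) = ∑ i ∈ s, D.w (f i) := by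
  classical
  induction s using Finset.induction_on with
  | empty => simp [w_one]
  | insert a s ha ih =>
    rw [Finset.prod_insert ha, Finset.sum_insert ha, D.mul, ih]
    · exact fun i hi => hf i (Finset.mem_insert_of_mem hi)
    · exact hf a (Finset.mem_insert_self _ _)
    · exact Finset.prod_ne_zero_iff.2 fun i hi => hf i (Finset.mem_insert_of_mem hi)

lemma M_add {j : ℤ} {x y : L} (hx : D.M j x) (hy : D.M j y) : D.M j (x + y) := by
  by_cases h0 : x = 0
  · subst h0; simpa using hy
  by_cases h1 : y = 0
  · subst h1; simpa using hx
  rw [M_iff h0] at hx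
  rw [M_iff h1] at hy
  by_cases h : x + y = 0
  · exact Or.inl h
  · exact Or.inr ((le_min hx hy).trans (D.add x y h0 h1 h))

lemma M_neg {j : ℤ} {x : L} (hx : D.M j x) : D.M j (-x) := by
  rcases hx with rfl | hx
  · simpa using M_zero j
  · exact Or.inr (by rwa [w_neg])

lemma M_sub {j : ℤ} {x y : L} (hx : D.M j x) (hy : D.M j y) : D.M j (x - y) := by
  rw [sub_eq_add_neg]; exact M_add hx (M_neg hy)

lemma M_sum {ι : Type*} {j : ℤ} (s : Finset ι) (f : ι → L) (hf : ∀ i ∈ s, D.M j (f i)) :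
    D.M j (∑ i ∈ s, f i) := by
  classical
  induction s using Finset.induction_on with
  | empty => simpa using M_zero j
  | insert a s ha ih =>
    rw [Finset.sum_insert ha]
    exact M_add (hf a (Finset.mem_insert_self _ _))
      (ih fun i hi => hf i (Finset.mem_insert_of_mem hi))

lemma M_mul {i j : ℤ} {x y : L} (hx : D.M i x) (hy : D.M j y) : D.M (i + j) (x * y) := by
  by_cases h0 : x = 0
  · subst h0; simpa using M_zero _
  by_cases h1 : y = 0
  · subst h1; simpa using M_zero _
  rw [M_iff h0] at hx
  rw [M_iff h1] at hy
  rw [M_iff (mul_ne_zero h0 h1), D.mul x y h0 h1]; omega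

lemma M_mono {i j : ℤ} (h : i ≤ j) {x : L} (hx : D.M j x) : D.M i x :=
  hx.imp id fun h' => h.trans h'

lemma M_w (x : L) : D.M (D.w x) x := Or.inr le_rfl

lemma M_one : D.M 0 1 := Or.inr (by rw [w_one])

lemma M_t : D.M 1 D.t := Or.inr (by rw [D.w_t])

lemma M_pow {x : L} (hx : D.M 0 x) (n : ℕ) : D.M 0 (x ^ n) := by
  induction n with
  | zero => simpa using M_one
  | succ k ih => rw [pow_succ]; simpa using M_mul ih hx

lemma M_natCast (n : ℕ) : D.M 0 (n : L) := by
  induction n with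
  | zero => simpa using M_zero 0
  | succ k ih => push_cast; exact M_add ih M_one

/-- terms with distinct valuations -/
lemma M_terms {ι : Type*} {j : ℤ} (s : Finset ι) (f : ι → L)
    (hd : ∀ i ∈ s, ∀ k ∈ s, f i ≠ 0 → f k ≠ 0 → D.w (f i) = D.w (f k) → i = k)
    (h : D.M j (∑ i ∈ s, f i)) : ∀ i ∈ s, D.M j (f i) := by
  classical
  by_contra! hc
  obtain ⟨i, hi, hij⟩ := hc
  set S := s.filter (fun i => f i ≠ 0) with hS
  have hi0 : f i ≠ 0 := fun h0 => hij (Or.inl h0)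
  have hiS : i ∈ S := Finset.mem_filter.2 ⟨hi, hi0⟩
  obtain ⟨m, hm, hmin⟩ := Finset.exists_min_image S (fun i => D.w (f i)) ⟨i, hiS⟩
  have hms := (Finset.mem_filter.1 hm).1
  have hm0 := (Finset.mem_filter.1 hm).2
  have h1 : D.w (f m) < j := by
    refine lt_of_le_of_lt (hmin i hiS) ?_
    rw [M_iff hi0] at hij; omega
  have h2 : D.M (D.w (f m) + 1) (f m) := by
    have : f m = ∑ i ∈ s, f i - ∑ i ∈ s.erase m, f i := by
      rw [← Finset.add_sum_erase s f hms]; ring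
    have hle : D.w (f m) + 1 ≤ j := by omega
    generalize hq : D.w (f m) + 1 = q at hle ⊢
    rw [this]
    refine M_sub (M_mono hle h) (M_sum _ _ ?_)
    intro k hk
    by_cases hk0 : f k = 0
    · exact Or.inl hk0
    have hks := Finset.mem_of_mem_erase hk
    have h3 := hmin k (Finset.mem_filter.2 ⟨hks, hk0⟩)
    have h4 : D.w (f m) ≠ D.w (f k) := fun h' =>
      Finset.ne_of_mem_erase hk (hd m hms k hks hm0 hk0 h').symm
    rw [M_iff hk0]
    omega
  rw [M_iff hm0] at h2
  omega

lemma exists_M (x : L) : ∃ j, D.M j x := ⟨_, M_w x⟩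

section ext

variable {F : Type} [Field F] [Algebra F L]

/-- the smallest positive value on F -/
lemma exists_unif (hF : ∃ c : F, c ≠ 0 ∧ 0 < D.w (algebraMap F L c)) :
    ∃ (e : ℕ) (c : F), 0 < e ∧ c ≠ 0 ∧ D.w (algebraMap F L c) = e ∧
      ∀ b : F, b ≠ 0 → (e : ℤ) ∣ D.w (algebraMap F L b) := by
  classical
  have hmap : ∀ x : F, x ≠ 0 → algebraMap F L x ≠ 0 := fun x hx => by simpa using hx
  have hex : ∃ e : ℕ, 0 < e ∧ ∃ c : F, c ≠ 0 ∧ D.w (algebraMap F L c) = e := by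
    obtain ⟨c, hc, h⟩ := hF
    exact ⟨(D.w (algebraMap F L c)).toNat, by omega, c, hc, by omega⟩
  obtain ⟨he, c, hc, hce⟩ := Nat.find_spec hex
  refine ⟨Nat.find hex, c, he, hc, hce, ?_⟩
  intro b hb
  set e := Nat.find hex with hedef
  by_contra hnd
  have hmod := Int.emod_nonneg (D.w (algebraMap F L b)) (b := e) (by omega)
  have hlt := Int.emod_lt_of_pos (D.w (algebraMap F L b)) (b := e) (by omega)
  have hne : D.w (algebraMap F L b) % e ≠ 0 := fun h => hnd (Int.dvd_of_emod_eq_zero h)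
  refine Nat.find_min hex (m := (D.w (algebraMap F L b) % e).toNat) (by omega) ⟨by omega,
    b / c ^ (D.w (algebraMap F L b) / e), div_ne_zero hb (zpow_ne_zero _ hc), ?_⟩
  rw [map_div₀, map_zpow₀, w_div (hmap b hb) (zpow_ne_zero _ (hmap c hc)), w_zpow (hmap c hc), hce]
  have := Int.mul_ediv_add_emod (D.w (algebraMap F L b)) e
  rw [mul_comm] at this
  omega

variable [FiniteDimensional F L] [IsGalois F L]

lemma M_trace (hinv : ∀ (σ : L ≃ₐ[F] L) (x : L), x ≠ 0 → D.w (σ x) = D.w x) {j : ℤ} {x : L}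
    (hx : D.M j x) : D.M j (algebraMap F L (Algebra.trace F L x)) := by
  rw [trace_eq_sum_automorphisms]
  refine M_sum _ _ fun σ _ => ?_
  by_cases h0 : x = 0
  · simp [h0, M_zero]
  · rw [M_iff (by simpa using h0), hinv σ x h0]
    exact (M_iff h0).1 hx

lemma span_top (hinv : ∀ (σ : L ≃ₐ[F] L) (x : L), x ≠ 0 → D.w (σ x) = D.w x)
    (hres : ∀ x : L, D.M 0 x → ∃ c : F, D.M 1 (x - algebraMap F L c))
    (e : ℕ) (c : F) (he : 0 < e) (hc : c ≠ 0) (hce : D.w (algebraMap F L c) = e) :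
    Submodule.span F (Set.range fun j : Fin e => D.t ^ (j : ℕ)) = ⊤ := by
  set W := Submodule.span F (Set.range fun j : Fin e => D.t ^ (j : ℕ)) with hW
  have hc' : algebraMap F L c ≠ 0 := by simpa using hc
  have happ : ∀ r : ℕ, ∀ x : L, D.M 0 x → ∃ y ∈ W, D.M r (x - y) := by
    intro r x hx
    induction r with
    | zero => exact ⟨0, W.zero_mem, by simpa using hx⟩
    | succ r ih =>
      obtain ⟨y, hy, hr⟩ := ih
      set u : L := (algebraMap F L c) ^ (r / e) * D.t ^ (r % e) with hu
      have hu0 : u ≠ 0 := mul_ne_zero (pow_ne_zero _ hc') (pow_ne_zero _ D.t_ne)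
      have hwu : D.w u = r := by
        rw [hu, D.mul _ _ (pow_ne_zero _ hc') (pow_ne_zero _ D.t_ne), w_pow hc', w_pow D.t_ne,
          D.w_t, hce]
        have := Nat.div_add_mod r e
        rw [mul_comm] at this
        rw [mul_one]
        exact_mod_cast this
      have h0 : D.M 0 ((x - y) / u) := by
        have := M_mul hr (M_w (D := D) u⁻¹)
        rw [w_inv hu0, hwu] at this
        simpa [div_eq_mul_inv] using this
      obtain ⟨b, hb⟩ := hres _ h0
      refine ⟨y + algebraMap F L b * u, W.add_mem hy ?_, ?_⟩
      · rw [hu, ← mul_assoc, ← map_pow, ← map_mul, ← Algebra.smul_def]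
        exact W.smul_mem _ (Submodule.subset_span ⟨⟨r % e, Nat.mod_lt _ he⟩, rfl⟩)
      · have := M_mul hb (M_w (D := D) u)
        rw [hwu] at this
        have h2 : ((x - y) / u - algebraMap F L b) * u = x - (y + algebraMap F L b * u) := by
          field_simp; ring
        rw [h2] at this
        push_cast
        rwa [add_comm] at this
  by_contra hne
  obtain ⟨f, hf0, hfW⟩ := Submodule.exists_le_ker_of_lt_top W (lt_top_iff_ne_top.2 hne)
  have hnd := traceForm_nondegenerate F L
  set z := ((Algebra.traceForm F L).toDual hnd).symm f with hz
  have hfz : ∀ x, f x = Algebra.trace F L (z * x) := by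
    intro x
    rw [← LinearMap.BilinForm.apply_toDual_symm_apply (hB := hnd) f x]
    rfl
  obtain ⟨x, hx⟩ : ∃ x, f x ≠ 0 := by
    by_contra! h
    exact hf0 (LinearMap.ext h)
  have hx0 : x ≠ 0 := by rintro rfl; simp at hx
  -- scale
  obtain ⟨x, hx, hx0, hxM⟩ : ∃ x, f x ≠ 0 ∧ x ≠ 0 ∧ D.M 0 x := by
    refine ⟨c ^ (D.w x).natAbs • x, ?_, ?_, ?_⟩
    · rw [map_smul]; exact smul_ne_zero (pow_ne_zero _ hc) hx
    · exact smul_ne_zero (pow_ne_zero _ hc) hx0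
    · rw [Algebra.smul_def, map_pow, M_iff (mul_ne_zero (pow_ne_zero _ hc') hx0),
        D.mul _ _ (pow_ne_zero _ hc') hx0, w_pow hc', hce]
      have h1 : (1:ℤ) ≤ e := by exact_mod_cast he
      have h2 := neg_abs_le (D.w x)
      have h3 := abs_nonneg (D.w x)
      rw [Int.natCast_natAbs]
      nlinarith
  set k := D.w (algebraMap F L (f x)) with hk
  set r := (k + 1 - D.w z).toNat with hr
  obtain ⟨y, hy, hM⟩ := happ r x hxM
  have h1 : f x = Algebra.trace F L (z * (x - y)) := by
    rw [← hfz, map_sub, (LinearMap.mem_ker.1 (hfW hy)), sub_zero]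
  have h2 := M_trace hinv (M_mul (M_w (D := D) z) hM)
  rw [← h1, M_iff (by simpa using hx)] at h2
  omega

/-- everything about a totally ramified extension -/
lemma structure_thm (hinv : ∀ (σ : L ≃ₐ[F] L) (x : L), x ≠ 0 → D.w (σ x) = D.w x)
    (hres : ∀ x : L, D.M 0 x → ∃ c : F, D.M 1 (x - algebraMap F L c))
    (hF : ∃ c : F, c ≠ 0 ∧ 0 < D.w (algebraMap F L c)) :
    (∃ c : F, c ≠ 0 ∧ D.w (algebraMap F L c) = Module.finrank F L) ∧
    (∀ b : F, b ≠ 0 → (Module.finrank F L : ℤ) ∣ D.w (algebraMap F L b)) ∧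
    (∀ x : L, D.M 0 x → ∃ b : Fin (Module.finrank F L) → F,
      (∀ j, D.M 0 (algebraMap F L (b j))) ∧ x = ∑ j, algebraMap F L (b j) * D.t ^ (j : ℕ)) := by
  obtain ⟨e, c, he, hc, hce, hdvd⟩ := exists_unif (D := D) hF
  have hspan := span_top hinv hres e c he hc hce
  have hterms : ∀ (b : Fin e → F) (j : ℤ), D.M j (∑ i, algebraMap F L (b i) * D.t ^ (i : ℕ)) →
      ∀ i, D.M j (algebraMap F L (b i) * D.t ^ (i : ℕ)) := by
    intro b j h i
    refine M_terms Finset.univ _ ?_ h i (Finset.mem_univ _)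
    intro i _ k _ hi hk hik
    have hbi : b i ≠ 0 := by rintro h; simp [h] at hi
    have hbk : b k ≠ 0 := by rintro h; simp [h] at hk
    rw [D.mul _ _ (by simpa using hbi) (pow_ne_zero _ D.t_ne),
      D.mul _ _ (by simpa using hbk) (pow_ne_zero _ D.t_ne), w_pow D.t_ne, w_pow D.t_ne,
      D.w_t] at hik
    obtain ⟨a, ha⟩ := hdvd _ hbi
    obtain ⟨a', ha'⟩ := hdvd _ hbk
    rw [ha, ha'] at hik
    have h1 := i.2
    have h2 := k.2
    have : ((i : ℕ) : ℤ) = k := by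
      have e1 : ((e:ℤ) * a + (i:ℕ) * 1) % e = (i : ℕ) := by
        rw [mul_one, Int.mul_add_emod_self_left]; exact Int.emod_eq_of_lt (by omega) (by omega)
      have e2 : ((e:ℤ) * a' + (k:ℕ) * 1) % e = (k : ℕ) := by
        rw [mul_one, Int.mul_add_emod_self_left]; exact Int.emod_eq_of_lt (by omega) (by omega)
      rw [← e1, ← e2, hik]
    exact Fin.ext (by exact_mod_cast this)
  have hli : LinearIndependent F (fun j : Fin e => D.t ^ (j : ℕ)) := by
    rw [Fintype.linearIndependent_iff]
    intro g hg i
    by_contra hgi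
    have hx0 : algebraMap F L (g i) * D.t ^ (i : ℕ) ≠ 0 :=
      mul_ne_zero (by simpa using hgi) (pow_ne_zero _ D.t_ne)
    have := hterms g (D.w (algebraMap F L (g i) * D.t ^ (i : ℕ)) + 1) (by
      simp_rw [Algebra.smul_def] at hg
      rw [hg]; exact M_zero _) i
    rw [M_iff hx0] at this
    omega
  set B := Module.Basis.mk hli (by rw [hspan]) with hB
  have hfr : Module.finrank F L = e := by
    rw [Module.finrank_eq_card_basis B]; simp
  rw [hfr]
  refine ⟨⟨c, hc, hce⟩, hdvd, ?_⟩
  intro x hx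
  have hsum : x = ∑ j, algebraMap F L (B.repr x j) * D.t ^ (j : ℕ) := by
    conv_lhs => rw [← B.sum_repr x]
    simp [Algebra.smul_def, hB]
  refine ⟨fun j => B.repr x j, ?_, hsum⟩
  intro j
  rw [hsum] at hx
  have h := hterms (fun j => B.repr x j) 0 hx j
  by_cases h0 : B.repr x j = 0
  · simp only [h0, map_zero]; exact M_zero _
  have h0' : algebraMap F L (B.repr x j) ≠ 0 := by simpa using h0
  rw [M_iff (mul_ne_zero h0' (pow_ne_zero _ D.t_ne)), D.mul _ _ h0' (pow_ne_zero _ D.t_ne),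
    w_pow D.t_ne, D.w_t] at h
  rw [M_iff h0']
  obtain ⟨a, ha⟩ := hdvd _ h0
  rw [ha] at h ⊢
  have h1 := j.2
  by_contra hneg
  have : a ≤ -1 := by
    by_contra h'
    exact hneg (mul_nonneg (by omega) (by omega))
  have h3 : (e:ℤ) * a ≤ e * (-1) := mul_le_mul_of_nonneg_left this (by omega)
  omega

lemma t_inj (hinv : ∀ (σ : L ≃ₐ[F] L) (x : L), x ≠ 0 → D.w (σ x) = D.w x)
    (hres : ∀ x : L, D.M 0 x → ∃ c : F, D.M 1 (x - algebraMap F L c))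
    (hF : ∃ c : F, c ≠ 0 ∧ 0 < D.w (algebraMap F L c))
    (σ τ : L ≃ₐ[F] L) (h : σ D.t = τ D.t) : σ = τ := by
  obtain ⟨⟨c, hc, hce⟩, -, h3⟩ := structure_thm hinv hres hF
  have hc' : algebraMap F L c ≠ 0 := by simpa using hc
  have key : ∀ x, D.M 0 x → σ x = τ x := by
    intro x hx
    obtain ⟨b, -, hb⟩ := h3 x hx
    rw [hb]; simp [map_sum, h]
  ext x
  by_cases hx0 : x = 0
  · simp [hx0]
  have h4 := key (algebraMap F L c ^ (D.w x).natAbs * x) (by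
    rw [M_iff (mul_ne_zero (pow_ne_zero _ hc') hx0),
        D.mul _ _ (pow_ne_zero _ hc') hx0, w_pow hc', hce]
    have h1 : (1:ℤ) ≤ (Module.finrank F L : ℕ) := by exact_mod_cast Module.finrank_pos
    have h2 := neg_abs_le (D.w x)
    have h3 := abs_nonneg (D.w x)
    rw [Int.natCast_natAbs]
    nlinarith)
  simpa [hc] using h4

open Classical in
lemma trace_thm (hinv : ∀ (σ : L ≃ₐ[F] L) (x : L), x ≠ 0 → D.w (σ x) = D.w x)
    (hres : ∀ x : L, D.M 0 x → ∃ c : F, D.M 1 (x - algebraMap F L c))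
    (hF : ∃ c : F, c ≠ 0 ∧ 0 < D.w (algebraMap F L c)) (d : ℤ)
    (hd : d = ∑ σ ∈ (Finset.univ : Finset (L ≃ₐ[F] L)).erase 1, D.w (σ D.t - D.t)) :
    (∀ x : L, D.M (-d) x → D.M 0 (algebraMap F L (Algebra.trace F L x))) ∧
    (∃ x : L, x ≠ 0 ∧ D.w x = Module.finrank F L - 1 - d ∧ Algebra.trace F L x = 1) := by
  obtain ⟨-, -, h3⟩ := structure_thm hinv hres hF
  have hinj := t_inj hinv hres hF
  set N := Module.finrank F L with hN
  have hNpos : 0 < N := Module.finrank_pos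
  have hcard : (Finset.univ : Finset (L ≃ₐ[F] L)).card = N := by
    rw [Finset.card_univ, ← Nat.card_eq_fintype_card, IsGalois.card_aut_eq_finrank]
  set δ : L := ∏ σ ∈ (Finset.univ : Finset (L ≃ₐ[F] L)).erase 1, (D.t - σ D.t) with hδ
  have hfac : ∀ σ ∈ (Finset.univ : Finset (L ≃ₐ[F] L)).erase 1, (D.t - σ D.t) ≠ 0 := by
    intro σ hσ h
    exact Finset.ne_of_mem_erase hσ (hinj σ 1 (by simpa using (sub_eq_zero.1 h).symm))
  have hδ0 : δ ≠ 0 := Finset.prod_ne_zero_iff.2 hfac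
  have hwδ : D.w δ = d := by
    rw [hδ, w_prod _ _ hfac, hd]
    refine Finset.sum_congr rfl fun σ _ => ?_
    rw [← neg_sub, w_neg]
  have key : ∀ b : Fin N → F, Algebra.trace F L ((∑ j, algebraMap F L (b j) * D.t ^ (j : ℕ)) / δ)
      = b ⟨N - 1, by omega⟩ := by
    intro b
    apply FaithfulSMul.algebraMap_injective F L
    rw [trace_eq_sum_automorphisms]
    set P : Polynomial L := ∑ j : Fin N, Polynomial.C (algebraMap F L (b j)) * Polynomial.X ^ (j : ℕ)
      with hP
    have hdeg : P.degree < (Finset.univ : Finset (L ≃ₐ[F] L)).card := by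
      rw [hcard]
      exact Polynomial.degree_sum_fin_lt _
    have h := Lagrange.coeff_eq_sum (s := (Finset.univ : Finset (L ≃ₐ[F] L)))
      (v := fun σ => σ D.t) (fun σ _ τ _ h => hinj σ τ h) hdeg
    rw [hcard] at h
    have hco : P.coeff (N - 1) = algebraMap F L (b ⟨N - 1, by omega⟩) := by
      rw [hP, Polynomial.finsetSum_coeff]
      simp only [Polynomial.coeff_C_mul_X_pow]
      rw [Finset.sum_eq_single ⟨N - 1, by omega⟩]
      · simp
      · intro j _ hj
        rw [if_neg]
        intro h'
        exact hj (Fin.ext h'.symm)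
      · simp
    rw [← hco, h]
    refine Finset.sum_congr rfl fun σ _ => ?_
    rw [map_div₀]
    congr 1
    · simp [hP, Polynomial.eval_finsetSum, map_sum]
    · rw [hδ, map_prod]
      refine Finset.prod_bij (fun τ _ => σ * τ) ?_ ?_ ?_ ?_
      · intro τ hτ
        have := Finset.ne_of_mem_erase hτ
        simpa using this
      · intro a _ b _ h
        exact mul_left_cancel h
      · intro τ hτ
        refine ⟨σ⁻¹ * τ, ?_, by simp⟩
        have := Finset.ne_of_mem_erase hτ
        simp only [Finset.mem_erase, Finset.mem_univ, and_true, ne_eq, inv_mul_eq_one]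
        exact fun h => this h.symm
      · intro τ _
        simp
  constructor
  · intro x hx
    have h0 : D.M 0 (x * δ) := by
      have := M_mul hx (M_w (D := D) δ)
      rwa [hwδ, neg_add_cancel] at this
    obtain ⟨b, hb, hb'⟩ := h3 _ h0
    have h4 : x = (∑ j, algebraMap F L (b j) * D.t ^ (j : ℕ)) / δ := by
      rw [← hb']; field_simp
    rw [h4, key]
    exact hb _
  · refine ⟨D.t ^ (N - 1) / δ, div_ne_zero (pow_ne_zero _ D.t_ne) hδ0, ?_, ?_⟩
    · rw [w_div (pow_ne_zero _ D.t_ne) hδ0, hwδ, w_pow D.t_ne, D.w_t]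
      push_cast [hNpos]
      ring
    · have h5 := key (Pi.single ⟨N - 1, by omega⟩ 1)
      rw [Finset.sum_eq_single ⟨N - 1, by omega⟩] at h5
      · simpa using h5
      · intro j _ hj
        simp [Pi.single_eq_of_ne hj]
      · simp

end ext

end DV



namespace DV

variable {K L : Type} [Field K] [Field L] [Algebra K L] [FiniteDimensional K L] [IsGalois K L]
  {D : DV L}

open Classical in
/-- different exponent of a subgroup -/
noncomputable def dd (D : DV L) (H : Subgroup (L ≃ₐ[K] L)) : ℤ :=
  ∑ σ ∈ (Finset.univ.filter (· ∈ H)).erase 1, D.w (σ D.t - D.t)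

open Classical in
lemma sub_thm (hinv : ∀ (σ : L ≃ₐ[K] L) (x : L), x ≠ 0 → D.w (σ x) = D.w x)
    (hres : ∀ x : L, D.M 0 x → ∃ c : K, D.M 1 (x - algebraMap K L c))
    (hF : ∃ c : K, c ≠ 0 ∧ 0 < D.w (algebraMap K L c)) (H : Subgroup (L ≃ₐ[K] L)) :
    (∃ c : L, c ≠ 0 ∧ (∀ σ ∈ H, σ c = c) ∧ D.w c = Nat.card H) ∧
    (∀ x : L, D.M (-dd D H) x → D.M 0 (∑ σ ∈ Finset.univ.filter (· ∈ H), σ x)) ∧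
    (∃ x : L, x ≠ 0 ∧ D.w x = Nat.card H - 1 - dd D H ∧
      ∑ σ ∈ Finset.univ.filter (· ∈ H), σ x = 1) := by
  set F := IntermediateField.fixedField H with hFdef
  have hinv' : ∀ (σ : L ≃ₐ[F] L) (x : L), x ≠ 0 → D.w (σ x) = D.w x := fun σ x hx =>
    hinv (σ.restrictScalars K) x hx
  have hres' : ∀ x : L, D.M 0 x → ∃ c : F, D.M 1 (x - algebraMap F L c) := by
    intro x hx
    obtain ⟨c, hc⟩ := hres x hx
    exact ⟨algebraMap K F c, hc⟩
  have hF' : ∃ c : F, c ≠ 0 ∧ 0 < D.w (algebraMap F L c) := by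
    obtain ⟨c, hc, h⟩ := hF
    exact ⟨algebraMap K F c, by simpa using hc, h⟩
  have hfr : Module.finrank F L = Nat.card H := IntermediateField.finrank_fixedField_eq_card H
  set E := IntermediateField.subgroupEquivAlgEquiv H with hE
  have hEapp : ∀ (σ : H) (x : L), E σ x = σ.1 x := fun σ x => rfl
  have hsum : ∀ f : (L → L) → L, ∑ σ : L ≃ₐ[F] L, f σ =
      ∑ σ ∈ Finset.univ.filter (· ∈ H), f σ := by
    intro f
    rw [← Equiv.sum_comp E.toEquiv, Finset.sum_subtype (Finset.univ.filter (· ∈ H)) (p := (· ∈ H))]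
    · rfl
    · simp
  have hsum' : ∑ σ ∈ (Finset.univ : Finset (L ≃ₐ[F] L)).erase 1, D.w (σ D.t - D.t) = dd D H := by
    rw [dd]
    refine (Finset.sum_bij (fun σ hσ => E ⟨σ, by simpa using Finset.mem_of_mem_erase hσ⟩)
      ?_ ?_ ?_ ?_).symm
    · intro σ hσ
      have := Finset.ne_of_mem_erase hσ
      simpa [← Subtype.coe_inj] using this
    · intro a _ b _ h
      have := E.injective h
      simpa using this
    · intro b hb
      refine ⟨(E.symm b).1, ?_, by simp⟩
      have := Finset.ne_of_mem_erase hb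
      simpa using this
    · intro σ _; rfl
  have htr : ∀ x, algebraMap F L (Algebra.trace F L x) = ∑ σ ∈ Finset.univ.filter (· ∈ H), σ x := by
    intro x
    rw [trace_eq_sum_automorphisms]
    exact hsum fun f => f x
  obtain ⟨⟨c, hc, hce⟩, -, -⟩ := structure_thm hinv' hres' hF'
  obtain ⟨h1, x, hx0, hwx, hx1⟩ := trace_thm hinv' hres' hF' _ hsum'.symm
  refine ⟨⟨c, by simpa using hc, ?_, by rw [← hfr]; exact hce⟩, ?_, x, hx0, by rw [← hfr]; exact hwx, ?_⟩
  · intro σ hσ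
    exact c.2 ⟨σ, hσ⟩
  · intro x hx
    rw [← htr]; exact h1 x hx
  · rw [← htr, hx1, map_one]

open Classical in
lemma dd_sub {H H' : Subgroup (L ≃ₐ[K] L)} (hle : H' ≤ H) :
    dd D H - dd D H' = ∑ σ ∈ Finset.univ.filter (fun σ => σ ∈ H ∧ σ ∉ H'), D.w (σ D.t - D.t) := by
  rw [dd, dd, ← Finset.sum_sdiff (s₁ := (Finset.univ.filter (· ∈ H')).erase 1)
    (s₂ := (Finset.univ.filter (· ∈ H)).erase 1), add_sub_cancel_right]
  · congr 1
    ext σ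
    simp only [Finset.mem_sdiff, Finset.mem_erase, Finset.mem_filter, Finset.mem_univ, true_and]
    constructor
    · rintro ⟨h1, h2⟩
      exact ⟨h1.2, fun h => h2 ⟨h1.1, h⟩⟩
    · rintro ⟨h1, h2⟩
      exact ⟨⟨fun h => h2 (h ▸ H'.one_mem), h1⟩, fun h => h2 h.2⟩
  · intro σ
    simp only [Finset.mem_erase, Finset.mem_filter, Finset.mem_univ, true_and]
    exact fun h => ⟨h.1, hle h.2⟩

open Classical in
lemma card_sdiff_sub {H H' : Subgroup (L ≃ₐ[K] L)} (hle : H' ≤ H) :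
    ((Finset.univ.filter (fun σ => σ ∈ H ∧ σ ∉ H')).card : ℤ) = Nat.card H - Nat.card H' := by
  have h1 : (Finset.univ.filter (· ∈ H)).card = Nat.card H := by
    rw [Nat.card_eq_fintype_card, Fintype.card_subtype]
  have h2 : (Finset.univ.filter (· ∈ H')).card = Nat.card H' := by
    rw [Nat.card_eq_fintype_card, Fintype.card_subtype]
  rw [← h1, ← h2]
  have : Finset.univ.filter (fun σ => σ ∈ H ∧ σ ∉ H') =
      Finset.univ.filter (· ∈ H) \ Finset.univ.filter (· ∈ H') := by
    ext σ; simp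
  rw [this, Finset.card_sdiff_of_subset, Nat.cast_sub]
  · apply Finset.card_le_card; intro σ; simpa using @hle σ
  · intro σ; simpa using @hle σ

open Classical in
lemma ineq [CharZero L] (hinv : ∀ (σ : L ≃ₐ[K] L) (x : L), x ≠ 0 → D.w (σ x) = D.w x)
    (hres : ∀ x : L, D.M 0 x → ∃ c : K, D.M 1 (x - algebraMap K L c))
    (hF : ∃ c : K, c ≠ 0 ∧ 0 < D.w (algebraMap K L c)) {H H' : Subgroup (L ≃ₐ[K] L)}
    (hle : H' ≤ H) :
    ∑ σ ∈ Finset.univ.filter (fun σ => σ ∈ H ∧ σ ∉ H'), (D.w (σ D.t - D.t) - 1)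
      ≤ D.w (Nat.card H : L) - D.w (Nat.card H' : L) := by
  rw [Finset.sum_sub_distrib, ← dd_sub hle, Finset.sum_const, nsmul_eq_mul, mul_one,
    card_sdiff_sub hle]
  obtain ⟨-, -, x, hx0, hwx, hx1⟩ := sub_thm hinv hres hF H'
  obtain ⟨⟨c, hc0, hcH, hwc⟩, h2, -⟩ := sub_thm hinv hres hF H
  set N := Nat.card H with hN
  set N' := Nat.card H' with hN'
  have hNpos : 0 < N := Nat.card_pos
  have hN'pos : 0 < N' := Nat.card_pos
  set S := ∑ σ ∈ Finset.univ.filter (· ∈ H), σ x with hS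
  have hNS : (N' : L) * S = N := by
    have h1 : ∑ σ ∈ Finset.univ.filter (· ∈ H), σ (∑ τ ∈ Finset.univ.filter (· ∈ H'), τ x) = N := by
      rw [hx1]
      simp only [map_one, Finset.sum_const, nsmul_eq_mul, mul_one]
      rw [hN, Nat.card_eq_fintype_card, Fintype.card_subtype]
    rw [← h1]
    simp only [map_sum]
    rw [Finset.sum_comm]
    have h3 : ∀ τ ∈ Finset.univ.filter (· ∈ H'), ∑ σ ∈ Finset.univ.filter (· ∈ H), σ (τ x) = S := by
      intro τ hτ
      have hτ' : τ ∈ H := hle (by simpa using hτ)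
      refine Finset.sum_bij (fun σ _ => σ * τ) ?_ ?_ ?_ ?_
      · intro σ hσ
        have : σ ∈ H := by simpa using hσ
        simpa using H.mul_mem this hτ'
      · intro a _ b _ h; exact mul_right_cancel h
      · intro σ hσ
        have : σ ∈ H := by simpa using hσ
        exact ⟨σ * τ⁻¹, by simpa using H.mul_mem this (H.inv_mem hτ'), by simp⟩
      · intro σ _; rfl
    rw [Finset.sum_congr rfl h3, Finset.sum_const, nsmul_eq_mul, hN', Nat.card_eq_fintype_card,
      Fintype.card_subtype]
  have hN0 : (N : L) ≠ 0 := by exact_mod_cast hNpos.ne'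
  have hN'0 : (N' : L) ≠ 0 := by exact_mod_cast hN'pos.ne'
  have hS0 : S ≠ 0 := by rintro h; rw [h, mul_zero] at hNS; exact hN0 hNS.symm
  have hwS : D.w (N : L) - D.w (N' : L) = D.w S := by
    rw [← hNS, D.mul _ _ hN'0 hS0]; ring
  rw [hwS]
  set k : ℤ := (D.w x + dd D H) / N with hk
  have hk1 := Int.emod_add_mul_ediv (D.w x + dd D H) N
  have hk2 := Int.emod_lt_of_pos (D.w x + dd D H) (b := N) (by omega)
  have hk3 := Int.emod_nonneg (D.w x + dd D H) (b := N) (by omega)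
  rw [← hk] at hk1
  have hck : c ^ k ≠ 0 := zpow_ne_zero _ hc0
  have h4 := h2 (x / c ^ k) (by
    rw [M_iff (div_ne_zero hx0 hck), w_div hx0 hck, w_zpow hc0, hwc]
    have : k * N = N * k := mul_comm _ _
    omega)
  have h5 : ∑ σ ∈ Finset.univ.filter (· ∈ H), σ (x / c ^ k) = S / c ^ k := by
    rw [hS, Finset.sum_div]
    refine Finset.sum_congr rfl fun σ hσ => ?_
    rw [map_div₀, map_zpow₀, hcH σ (by simpa using hσ)]
  rw [h5, M_iff (div_ne_zero hS0 hck), w_div hS0 hck, w_zpow hc0, hwc] at h4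
  have : k * N = N * k := mul_comm _ _
  omega

/-- lower ramification groups -/
def Gr (hinv : ∀ (σ : L ≃ₐ[K] L) (x : L), x ≠ 0 → D.w (σ x) = D.w x) (j : ℤ) :
    Subgroup (L ≃ₐ[K] L) where
  carrier := {σ | ∀ x, D.M 0 x → D.M (j + 1) (σ x - x)}
  one_mem' := fun x _ => by simpa using M_zero _
  mul_mem' := by
    intro σ τ hσ hτ x hx
    have h0 : D.M 0 (τ x) := by
      by_cases h : x = 0
      · simpa [h] using M_zero _
      · rw [M_iff (by simpa using h), hinv τ x h]; exact (M_iff h).1 hx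
    have := M_add (hσ _ h0) (hτ x hx)
    simpa using this
  inv_mem' := by
    intro σ hσ x hx
    have h0 : D.M 0 (σ⁻¹ x) := by
      by_cases h : x = 0
      · simpa [h] using M_zero _
      · rw [M_iff (by simpa using h), hinv _ x h]; exact (M_iff h).1 hx
    have h1 := M_neg (hσ _ h0)
    have h2 : σ (σ⁻¹ x) = x := by rw [← AlgEquiv.mul_apply, mul_inv_cancel]; rfl
    rw [h2] at h1
    simpa using h1

lemma mem_Gr (hinv : ∀ (σ : L ≃ₐ[K] L) (x : L), x ≠ 0 → D.w (σ x) = D.w x)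
    (hres : ∀ x : L, D.M 0 x → ∃ c : K, D.M 1 (x - algebraMap K L c))
    (hF : ∃ c : K, c ≠ 0 ∧ 0 < D.w (algebraMap K L c)) (j : ℤ) (σ : L ≃ₐ[K] L) :
    σ ∈ Gr hinv j ↔ D.M (j + 1) (σ D.t - D.t) := by
  constructor
  · intro h
    exact h D.t (M_mono zero_le_one M_t)
  · intro h x hx
    obtain ⟨-, -, h3⟩ := structure_thm hinv hres hF
    obtain ⟨b, hb, rfl⟩ := h3 x hx
    have ht : D.M 0 (σ D.t) := by
      rw [M_iff (by simpa using D.t_ne), hinv _ _ D.t_ne, D.w_t]; norm_num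
    have ht' : D.M 0 D.t := M_mono zero_le_one M_t
    rw [map_sum, ← Finset.sum_sub_distrib]
    refine M_sum _ _ fun i _ => ?_
    rw [map_mul, map_pow, AlgEquiv.commutes, ← mul_sub, ← (Commute.all _ _).geom_sum₂_mul]
    have h1 : D.M 0 (∑ k ∈ Finset.range i, σ D.t ^ k * D.t ^ ((i : ℕ) - 1 - k)) :=
      M_sum _ _ fun k _ => by simpa using M_mul (M_pow ht k) (M_pow ht' _)
    have := M_mul (hb i) (M_mul h1 h)
    simpa using this

variable (D) in
/-- ring of integers -/
def O : Subring L where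
  carrier := {x | D.M 0 x}
  mul_mem' := fun ha hb => by simpa using M_mul ha hb
  one_mem' := M_one
  add_mem' := M_add
  zero_mem' := M_zero 0
  neg_mem' := M_neg

lemma pow_sub_one {p : ℕ} (hpp : p.Prime) (hp : Odd p) (hpM : D.M 1 (p : L)) (i : ℕ) {u : L}
    (hu : D.M 0 u) (h : D.M 1 (u ^ p ^ i - 1)) : D.M 1 (u - 1) := by
  have hu' : u ∈ D.O := hu
  obtain ⟨r, hr⟩ := exists_add_pow_prime_pow_eq hpp (⟨u, hu'⟩ : D.O) (-1) i
  have hr' := congrArg (Subtype.val : D.O → L) hr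
  push_cast at hr'
  rw [(hp.pow (n := i)).neg_one_pow] at hr'
  have hrM : D.M 0 r.1 := r.2
  have h1 : D.M 1 ((u + -1) ^ p ^ i) := by
    rw [hr']
    refine M_add (by simpa [sub_eq_add_neg] using h) ?_
    have := M_neg (M_mul (M_mul hpM hu) hrM)
    simpa using this
  rw [← sub_eq_add_neg] at h1
  by_cases h0 : u - 1 = 0
  · exact Or.inl h0
  rw [M_iff (pow_ne_zero _ h0), w_pow h0] at h1
  rw [M_iff h0]
  by_contra hc
  have : ((p ^ i : ℕ) : ℤ) * D.w (u - 1) ≤ 0 :=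
    mul_nonpos_of_nonneg_of_nonpos (by positivity) (by omega)
  omega

lemma tame {p : ℕ} (hpp : p.Prime) (hp : Odd p) (hpM : D.M 1 (p : L))
    (hinv : ∀ (σ : L ≃ₐ[K] L) (x : L), x ≠ 0 → D.w (σ x) = D.w x)
    (hres : ∀ x : L, D.M 0 x → ∃ c : K, D.M 1 (x - algebraMap K L c))
    (hF : ∃ c : K, c ≠ 0 ∧ 0 < D.w (algebraMap K L c))
    (hab : ∀ σ τ : L ≃ₐ[K] L, σ * τ = τ * σ)
    (h0 : ∀ σ : L ≃ₐ[K] L, σ ∈ Gr hinv 0) (i : ℕ) (σ τ : L ≃ₐ[K] L)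
    (hσ1 : σ D.t - D.t ≠ 0) (hσ : D.w (σ D.t - D.t) = (p ^ i : ℕ) + 1) :
    D.M 2 (τ D.t - D.t) := by
  have ht := D.t_ne
  set b := p ^ i with hb
  set a := (σ D.t - D.t) / D.t with ha
  set u := τ D.t / D.t with hu
  have hτt : τ D.t ≠ 0 := by simpa using ht
  have hu0 : u ≠ 0 := div_ne_zero hτt ht
  have hwu : D.w u = 0 := by rw [hu, w_div hτt ht, hinv _ _ ht]; ring
  have ha0 : a ≠ 0 := div_ne_zero hσ1 ht
  have hwa : D.w a = b := by rw [ha, w_div hσ1 ht, hσ, D.w_t]; ring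
  set ε := a / D.t ^ b with hε
  have htb : D.t ^ b ≠ 0 := pow_ne_zero _ ht
  have hε0 : ε ≠ 0 := div_ne_zero ha0 htb
  have hwε : D.w ε = 0 := by rw [hε, w_div ha0 htb, hwa, w_pow ht, D.w_t]; ring
  have eσ : σ D.t = D.t * (1 + a) := by rw [ha]; field_simp; ring
  have eτ : τ D.t = u * D.t := by rw [hu]; field_simp
  have hcomm : σ (τ D.t) = τ (σ D.t) := by
    have := congrArg (fun f : L ≃ₐ[K] L => f D.t) (hab σ τ)
    simpa using this
  have hc2 : σ u * (1 + a) = u * (1 + τ a) := by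
    rw [eτ, map_mul, eσ, map_mul, eτ, map_add, map_one] at hcomm
    apply mul_left_cancel₀ ht
    linear_combination hcomm
  have hσb : σ ∈ Gr hinv b := by
    rw [mem_Gr hinv hres hF, M_iff hσ1, hσ]
  have h1 : D.M (b + 1) (u * (τ a - a)) := by
    have e : u * (τ a - a) = (σ u - u) * (1 + a) := by linear_combination -hc2
    rw [e]
    have h2 : D.M 0 (1 + a) := M_add M_one (Or.inr (by rw [hwa]; positivity))
    simpa using M_mul (hσb u (Or.inr hwu.ge)) h2
  have h2 : D.M (b + 1) (τ a - a) := by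
    have := M_mul (M_w (D := D) u⁻¹) h1
    rw [w_inv hu0, hwu] at this
    simpa [hu0] using this
  have eε : a = ε * D.t ^ b := by rw [hε]; field_simp
  have h3 : D.M 1 ((τ ε - ε) * u ^ b + ε * (u ^ b - 1)) := by
    have e : (τ ε - ε) * u ^ b + ε * (u ^ b - 1) = (τ a - a) * (D.t ^ b)⁻¹ := by
      rw [eε, map_mul, map_pow, eτ, mul_pow]; field_simp; ring
    rw [e]
    have := M_mul h2 (M_w (D := D) (D.t ^ b)⁻¹)
    rw [w_inv htb, w_pow ht, D.w_t] at this
    convert this using 1; ring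
  have hub : D.M 0 (u ^ b) := M_pow (Or.inr hwu.ge) _
  have h4 : D.M 1 ((τ ε - ε) * u ^ b) := by
    have := M_mul (h0 τ ε (Or.inr hwε.ge)) hub
    simpa using this
  have h5 : D.M 1 (ε * (u ^ b - 1)) := by simpa using M_sub h3 h4
  have h6 : D.M 1 (u ^ b - 1) := by
    have := M_mul (M_w (D := D) ε⁻¹) h5
    rw [w_inv hε0, hwε] at this
    simpa [hε0] using this
  have h7 := pow_sub_one hpp hp hpM i (Or.inr hwu.ge) h6
  have h8 := M_mul h7 (M_t (D := D))
  have e : τ D.t - D.t = (u - 1) * D.t := by rw [eτ]; ring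
  rw [e]
  exact h8

end DV



namespace DV

variable {K L : Type} [Field K] [Field L] [Algebra K L] [FiniteDimensional K L] [IsGalois K L]
  {D : DV L}

lemma Gr_anti (hinv : ∀ (σ : L ≃ₐ[K] L) (x : L), x ≠ 0 → D.w (σ x) = D.w x) {i j : ℤ}
    (h : i ≤ j) : Gr hinv j ≤ Gr hinv i :=
  fun _ hσ x hx => M_mono (by omega) (hσ x hx)

open Classical in
lemma ram_thm [CharZero L] {p : ℕ} (hpp : p.Prime) (hp : Odd p)
    (hinv : ∀ (σ : L ≃ₐ[K] L) (x : L), x ≠ 0 → D.w (σ x) = D.w x)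
    (hres : ∀ x : L, D.M 0 x → ∃ c : K, D.M 1 (x - algebraMap K L c))
    (hab : ∀ σ τ : L ≃ₐ[K] L, σ * τ = τ * σ)
    (h0 : ∀ σ : L ≃ₐ[K] L, σ ∈ Gr hinv 0) (n : ℕ) (hn : 1 ≤ n)
    (hwp : D.w (p : L) = ((p - 1) * p ^ n : ℕ))
    (hcG : Nat.card (L ≃ₐ[K] L) = (p - 1) * p ^ n)
    (m : ℕ → ℕ)
    (hcard : ∀ i, 1 ≤ i → i ≤ n + 1 → Nat.card (Gr hinv (m i)) = p ^ (n + 1 - i))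
    (hnest : ∀ i, 1 ≤ i → i ≤ n → Gr hinv (m (i + 1)) ≤ Gr hinv (m i))
    (hphi : n * ((p - 1) * p ^ n) ≤ ∑ j ∈ Finset.Icc 1 (m n), Nat.card (Gr hinv (j : ℤ))) :
    dd D (⊤ : Subgroup (L ≃ₐ[K] L)) = (n + 1) * ((p - 1) * p ^ n : ℕ) - (p ^ n : ℕ) := by
  have hp3 : 3 ≤ p := by
    have := hpp.two_le
    obtain ⟨k, hk⟩ := hp
    omega
  have hppos : 0 < p ^ n := by positivity
  have hp0 : (p : L) ≠ 0 := by exact_mod_cast hpp.ne_zero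
  have hwp1 : 1 ≤ D.w (p : L) := by
    rw [hwp]
    have : 0 < (p - 1) * p ^ n := Nat.mul_pos (by omega) hppos
    omega
  have hpM : D.M 1 (p : L) := Or.inr hwp1
  have hF : ∃ c : K, c ≠ 0 ∧ 0 < D.w (algebraMap K L c) := by
    refine ⟨(p : K), ?_, by rw [map_natCast]; omega⟩
    intro h
    apply hp0
    rw [← map_natCast (algebraMap K L), h, map_zero]
  have hinj : ∀ σ : L ≃ₐ[K] L, σ ≠ 1 → σ D.t - D.t ≠ 0 := fun σ hσ h =>
    hσ (t_inj hinv hres hF σ 1 (by simpa using sub_eq_zero.1 h))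
  have hmem : ∀ (σ : L ≃ₐ[K] L) (j : ℤ), σ ≠ 1 → (σ ∈ Gr hinv j ↔ j + 1 ≤ D.w (σ D.t - D.t)) := by
    intro σ j hσ
    rw [mem_Gr hinv hres hF, M_iff (hinj σ hσ)]
  have hw1 : ∀ σ : L ≃ₐ[K] L, σ ≠ 1 → 1 ≤ D.w (σ D.t - D.t) := fun σ hσ => by
    simpa using (hmem σ 0 hσ).1 (h0 σ)
  have hp10 : ((p - 1 : ℕ) : L) ≠ 0 := by
    have : p - 1 ≠ 0 := by omega
    exact_mod_cast this
  have hwp10 : D.w ((p - 1 : ℕ) : L) = 0 := by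
    have h1 := (M_iff hp10).1 (M_natCast (D := D) (p - 1))
    by_contra hne
    have h2 : D.M 1 ((p - 1 : ℕ) : L) := Or.inr (by omega)
    have h3 := M_sub hpM h2
    have h4 : (p : L) - ((p - 1 : ℕ) : L) = 1 := by
      rw [Nat.cast_sub (by omega)]; push_cast; ring
    rw [h4, M_iff one_ne_zero, w_one] at h3
    omega
  have hwpk : ∀ k : ℕ, D.w ((p ^ k : ℕ) : L) = k * D.w (p : L) := by
    intro k; push_cast; exact w_pow hp0 k
  -- the tame element
  have htop : Nat.card (⊤ : Subgroup (L ≃ₐ[K] L)) = (p - 1) * p ^ n := by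
    rw [Subgroup.card_top, hcG]
  have hc1 : Nat.card (Gr hinv (m 1)) = p ^ n := by
    rw [hcard 1 le_rfl (by omega)]; congr 1
  have htame1 : ∀ σ, σ ∉ Gr hinv (m 1) → D.w (σ D.t - D.t) = 1 := by
    have h1 := ineq hinv hres hF (le_top : Gr hinv (m 1) ≤ ⊤)
    rw [htop, hc1] at h1
    rw [Nat.cast_mul, D.mul _ _ hp10 (by exact_mod_cast hppos.ne'), hwp10, zero_add, sub_self] at h1
    have hnn : ∀ σ ∈ Finset.univ.filter
        (fun σ : L ≃ₐ[K] L => σ ∈ (⊤ : Subgroup (L ≃ₐ[K] L)) ∧ σ ∉ Gr hinv (m 1)),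
        0 ≤ D.w (σ D.t - D.t) - 1 := by
      intro σ hσ
      have h2 : σ ≠ 1 := by
        rintro rfl
        simp only [Finset.mem_filter] at hσ
        exact hσ.2.2 (Subgroup.one_mem _)
      have := hw1 σ h2
      omega
    have h2 := (Finset.sum_eq_zero_iff_of_nonneg hnn).1 (le_antisymm h1 (Finset.sum_nonneg hnn))
    intro σ hσ
    have := h2 σ (by simp [hσ])
    omega
  obtain ⟨τ, hτ⟩ : ∃ τ, τ ∉ Gr hinv (m 1) := by
    by_contra! h
    have : Gr hinv (m 1) = ⊤ := by ext; simp [h]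
    rw [this, htop] at hc1
    have : 2 * p ^ n ≤ (p - 1) * p ^ n := Nat.mul_le_mul_right _ (by omega)
    omega
  have hτ1 : ¬ D.M 2 (τ D.t - D.t) := by
    have hτ1 : τ ≠ 1 := by rintro rfl; exact hτ (Subgroup.one_mem _)
    rw [M_iff (hinj τ hτ1), htame1 τ hτ]
    norm_num
  -- bound at step i
  have hstep : ∀ i, 1 ≤ i → i ≤ n → ∀ σ, σ ∈ Gr hinv (m i) → σ ∉ Gr hinv (m (i + 1)) →
      D.w (σ D.t - D.t) ≤ (p ^ i : ℕ) := by
    intro i hi1 hin σ hσ hσ'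
    have hne : ∀ σ, σ ∉ Gr hinv (m (i + 1)) → σ ≠ 1 := by
      rintro σ h rfl; exact h (Subgroup.one_mem _)
    have hle := hnest i hi1 hin
    have hcc : Nat.card (Gr hinv (m i)) = p * Nat.card (Gr hinv (m (i + 1))) := by
      rw [hcard i hi1 (by omega), hcard (i + 1) (by omega) (by omega), ← pow_succ']
      congr 1; omega
    have hconst' : ∀ σ₁ σ₂, σ₁ ∈ Gr hinv (m i) → σ₁ ∉ Gr hinv (m (i + 1)) →
        σ₂ ∈ Gr hinv (m i) → σ₂ ∉ Gr hinv (m (i + 1)) →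
        D.w (σ₁ D.t - D.t) < D.w (σ₂ D.t - D.t) → False := by
      intro σ₁ σ₂ h1 h1' h2 h2' hlt
      set j := D.w (σ₂ D.t - D.t) - 1 with hj
      have hσ₂j : σ₂ ∈ Gr hinv j := by rw [hmem σ₂ j (hne _ h2')]; omega
      have hσ₁j : σ₁ ∉ Gr hinv j := by rw [hmem σ₁ j (hne _ h1')]; omega
      have hjm : j ≤ m (i + 1) := by
        rw [hmem σ₂ _ (hne _ h2')] at h2'; omega
      set T := Gr hinv j ⊓ Gr hinv (m i) with hT
      have hT1 : Gr hinv (m (i + 1)) ≤ T := le_inf (Gr_anti hinv hjm) hle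
      have hT2 : T ≤ Gr hinv (m i) := inf_le_right
      obtain ⟨a, ha⟩ := Subgroup.card_dvd_of_le hT1
      obtain ⟨c, hc⟩ := Subgroup.card_dvd_of_le hT2
      have hpos : 0 < Nat.card (Gr hinv (m (i + 1))) := Nat.card_pos
      have hac : p = a * c := by
        rw [ha, hcc] at hc
        apply Nat.eq_of_mul_eq_mul_left hpos
        rw [← mul_assoc, ← hc, mul_comm]
      rcases (Nat.dvd_prime hpp).1 ⟨c, hac⟩ with h | h
      · have : Gr hinv (m (i + 1)) = T :=
          Subgroup.eq_of_le_of_card_ge hT1 (by rw [ha, h, mul_one])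
        exact h2' (this ▸ ⟨hσ₂j, h2⟩)
      · have hc1 : c = 1 := by
          have : p * c = p * 1 := by rw [mul_one]; conv_rhs => rw [hac, h]
          exact Nat.eq_of_mul_eq_mul_left hpp.pos this
        have : T = Gr hinv (m i) :=
          Subgroup.eq_of_le_of_card_ge hT2 (by rw [hc, hc1, mul_one])
        exact hσ₁j (this.symm ▸ h1 : σ₁ ∈ T).1
    have h1 := ineq hinv hres hF hle
    have hsum : ∑ ρ ∈ Finset.univ.filter
        (fun ρ : L ≃ₐ[K] L => ρ ∈ Gr hinv (m i) ∧ ρ ∉ Gr hinv (m (i + 1))),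
        (D.w (ρ D.t - D.t) - 1) = (Finset.univ.filter
        (fun ρ : L ≃ₐ[K] L => ρ ∈ Gr hinv (m i) ∧ ρ ∉ Gr hinv (m (i + 1)))).card *
          (D.w (σ D.t - D.t) - 1) := by
      rw [← nsmul_eq_mul]
      apply Finset.sum_eq_card_nsmul
      intro ρ hρ
      simp only [Finset.mem_filter, Finset.mem_univ, true_and] at hρ
      have h2 := hconst' ρ σ hρ.1 hρ.2 hσ hσ'
      have h3 := hconst' σ ρ hσ hσ' hρ.1 hρ.2
      rcases lt_trichotomy (D.w (ρ D.t - D.t)) (D.w (σ D.t - D.t)) with h | h | h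
      · exact (h2 h).elim
      · rw [h]
      · exact (h3 h).elim
    rw [hsum, card_sdiff_sub hle, hcc, Nat.cast_mul, Nat.cast_mul,
      D.mul _ _ hp0 (by exact_mod_cast Nat.card_pos.ne'), add_sub_cancel_right, hwp,
      hcard (i + 1) (by omega) (by omega)] at h1
    have h2 : D.w (σ D.t - D.t) - 1 ≤ (p ^ i : ℕ) := by
      have e1 : n + 1 - (i + 1) = n - i := by omega
      have e2 : p ^ n = p ^ (n - i) * p ^ i := by rw [← pow_add]; congr 1; omega
      rw [e1, e2] at h1
      have hq : (0 : ℤ) < ((p : ℤ) - 1) * (p ^ (n - i) : ℕ) := by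
        apply mul_pos
        · omega
        · exact_mod_cast (by positivity)
      rw [Nat.cast_mul, Nat.cast_sub (by omega : 1 ≤ p), Nat.cast_mul] at h1
      refine le_of_mul_le_mul_left ?_ hq
      calc _ = ((p : ℤ) * (p ^ (n - i) : ℕ) - (p ^ (n - i) : ℕ)) * (D.w (σ D.t - D.t) - 1) := by ring
        _ ≤ _ := h1
        _ = _ := by push_cast; ring
    have h3 : D.w (σ D.t - D.t) ≠ (p ^ i : ℕ) + 1 := fun h =>
      hτ1 (tame hpp hp hpM hinv hres hF hab h0 i σ τ (hinj σ (hne σ hσ')) h)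
    omega
  -- E sums
  set E : Subgroup (L ≃ₐ[K] L) → ℤ := fun H => dd D H - (Nat.card H - 1) with hE
  have hEsub : ∀ {H H' : Subgroup (L ≃ₐ[K] L)}, H' ≤ H → E H - E H' =
      ∑ σ ∈ Finset.univ.filter (fun σ => σ ∈ H ∧ σ ∉ H'), (D.w (σ D.t - D.t) - 1) := by
    intro H H' hle
    rw [Finset.sum_sub_distrib, ← dd_sub hle, Finset.sum_const, nsmul_eq_mul, mul_one,
      card_sdiff_sub hle]
    simp only [hE]; ring
  have hEbot : E ⊥ = 0 := by
    have hdd : dd D (⊥ : Subgroup (L ≃ₐ[K] L)) = 0 := by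
      rw [dd]
      apply Finset.sum_eq_zero
      intro σ hσ
      exfalso
      have h1 := Finset.ne_of_mem_erase hσ
      have h2 := (Finset.mem_filter.1 (Finset.mem_of_mem_erase hσ)).2
      exact h1 (Subgroup.mem_bot.1 h2)
    simp [hE, hdd]
  have hbotn : Gr hinv (m (n + 1)) = ⊥ := by
    rw [← Subgroup.card_eq_one, hcard (n + 1) (by omega) le_rfl]; simp
  have hEstep : ∀ k, k ≤ n → E (Gr hinv (m (n + 1 - k))) ≤
      k * ((p - 1) * p ^ n : ℕ) - ((p ^ k : ℕ) - 1) := by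
    intro k
    induction k with
    | zero => intro _; simp only [Nat.sub_zero, hbotn, hEbot]; simp
    | succ k ih =>
      intro hk
      have ih := ih (by omega)
      set i := n + 1 - (k + 1) with hi
      have e1 : n + 1 - k = i + 1 := by omega
      rw [e1] at ih
      have hle := hnest i (by omega) (by omega)
      have h1 := hEsub hle
      have h2 : ∑ σ ∈ Finset.univ.filter (fun σ => σ ∈ Gr hinv (m i) ∧ σ ∉ Gr hinv (m (i + 1))),
          (D.w (σ D.t - D.t) - 1) ≤
          (Finset.univ.filter (fun σ : L ≃ₐ[K] L =>
            σ ∈ Gr hinv (m i) ∧ σ ∉ Gr hinv (m (i + 1)))).card • (((p ^ i : ℕ) : ℤ) - 1) := by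
        apply Finset.sum_le_card_nsmul
        intro σ hσ
        simp only [Finset.mem_filter, Finset.mem_univ, true_and] at hσ
        have := hstep i (by omega) (by omega) σ hσ.1 hσ.2
        omega
      rw [nsmul_eq_mul, card_sdiff_sub hle, hcard i (by omega) (by omega),
        hcard (i + 1) (by omega) (by omega)] at h2
      have e2 : n + 1 - i = k + 1 := by omega
      have e3 : n + 1 - (i + 1) = k := by omega
      have e4 : p ^ n = p ^ k * p ^ i := by rw [← pow_add]; congr 1; omega
      rw [e2, e3] at h2
      rw [e4] at ih ⊢
      rw [Nat.cast_mul, Nat.cast_sub (by omega : 1 ≤ p)] at ih ⊢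
      push_cast at h2 ih ⊢
      have h3 := h1.trans_le h2
      have h4 : ((p : ℤ) ^ (k + 1) - p ^ k) * (p ^ i - 1) =
        ((p : ℤ) - 1) * (p ^ k * p ^ i) - p ^ (k + 1) + p ^ k := by ring
      linarith
  have hE1 : E ⊤ = E (Gr hinv (m 1)) := by
    have h1 := hEsub (le_top : Gr hinv (m 1) ≤ ⊤)
    rw [Finset.sum_eq_zero] at h1
    · omega
    · intro σ hσ
      simp only [Finset.mem_filter, Finset.mem_univ, true_and] at hσ
      rw [htame1 σ hσ.2]; ring
  have hup := hEstep n le_rfl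
  rw [show n + 1 - n = 1 by omega, ← hE1] at hup
  -- lower bound
  have hmn : ((m n : ℕ) : ℤ) + 1 ≤ (p ^ n : ℕ) := by
    obtain ⟨σ, hσ, hσ'⟩ : ∃ σ, σ ∈ Gr hinv (m n) ∧ σ ∉ Gr hinv (m (n + 1)) := by
      by_contra! h
      have h1 := Subgroup.card_le_of_le h
      rw [hcard n hn (by omega), hcard (n + 1) (by omega) le_rfl] at h1
      simp at h1
      omega
    have h1 := hstep n hn le_rfl σ hσ hσ'
    have hne : σ ≠ 1 := by rintro rfl; exact hσ' (Subgroup.one_mem _)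
    rw [hmem σ _ hne] at hσ
    omega
  have hlow : ((∑ j ∈ Finset.Icc 1 (m n), Nat.card (Gr hinv (j : ℤ)) : ℕ) : ℤ) ≤ m n + E ⊤ := by
    have h1 : ∀ j : ℕ, Nat.card (Gr hinv (j : ℤ)) =
        ∑ σ : L ≃ₐ[K] L, if σ ∈ Gr hinv (j : ℤ) then 1 else 0 := by
      intro j
      rw [Nat.card_eq_fintype_card, Fintype.card_subtype, Finset.card_filter]
    simp_rw [h1]
    rw [Finset.sum_comm]
    simp_rw [← Finset.card_filter]
    rw [← Finset.add_sum_erase _ _ (Finset.mem_univ (1 : L ≃ₐ[K] L))]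
    push_cast
    have h2 := hEsub (bot_le : ⊥ ≤ (⊤ : Subgroup (L ≃ₐ[K] L)))
    rw [hEbot, sub_zero] at h2
    rw [h2]
    apply add_le_add
    · simp [Subgroup.one_mem]
    · have h3 : Finset.univ.filter (fun σ : L ≃ₐ[K] L =>
          σ ∈ (⊤ : Subgroup (L ≃ₐ[K] L)) ∧ σ ∉ (⊥ : Subgroup (L ≃ₐ[K] L))) =
          Finset.univ.erase 1 := by
        ext σ; simp
      rw [h3]
      apply Finset.sum_le_sum
      intro σ hσ
      have hne := Finset.ne_of_mem_erase hσ
      have h4 : (Finset.Icc 1 (m n)).filter (fun j : ℕ => σ ∈ Gr hinv (j : ℤ)) ⊆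
          Finset.Icc 1 (D.w (σ D.t - D.t) - 1).toNat := by
        intro j hj
        simp only [Finset.mem_filter, Finset.mem_Icc] at hj ⊢
        have := (hmem σ _ hne).1 hj.2
        omega
      have h5 := Finset.card_le_card h4
      rw [Nat.card_Icc] at h5
      have := hw1 σ hne
      omega
  have hphi' : ((n * ((p - 1) * p ^ n) : ℕ) : ℤ) ≤
      ((∑ j ∈ Finset.Icc 1 (m n), Nat.card (Gr hinv (j : ℤ)) : ℕ) : ℤ) := by exact_mod_cast hphi
  rw [Nat.cast_mul] at hphi'
  have hEtop : dd D (⊤ : Subgroup (L ≃ₐ[K] L)) = E ⊤ + (((p - 1) * p ^ n : ℕ) - 1) := by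
    simp only [hE]; rw [htop]; ring
  rw [hEtop, add_mul, one_mul]
  omega

end DV



/-- A rational valued valuation normalized by `q p = 1`. -/
structure QV (p : ℕ) (L : Type) [Field L] : Type where
  q : L → ℚ
  mul : ∀ x y, x ≠ 0 → y ≠ 0 → q (x * y) = q x + q y
  add : ∀ x y, x ≠ 0 → y ≠ 0 → x + y ≠ 0 → min (q x) (q y) ≤ q (x + y)
  q_p : q (p : L) = 1

namespace QV

variable {p : ℕ} {L : Type} [Field L] (D : QV p L)

def N (x : L) : Prop := x = 0 ∨ 0 ≤ D.q x
def P (x : L) : Prop := x = 0 ∨ 0 < D.q x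

def comap {K : Type} [Field K] (f : K →+* L) : QV p K where
  q := fun x => D.q (f x)
  mul := fun x y hx hy => by rw [map_mul]; exact D.mul _ _ (by simpa using hx) (by simpa using hy)
  add := fun x y hx hy h => by
    rw [map_add]
    exact D.add _ _ (by simpa using hx) (by simpa using hy)
      (by rw [← map_add]; exact (map_ne_zero f).2 h)
  q_p := by rw [map_natCast]; exact D.q_p

variable {D}

lemma q_one : D.q 1 = 0 := by
  have := D.mul 1 1 one_ne_zero one_ne_zero
  rw [mul_one] at this; linarith

lemma q_neg (x : L) : D.q (-x) = D.q x := by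
  by_cases hx : x = 0
  · simp [hx]
  have h1 : D.q (-1) = 0 := by
    have := D.mul (-1) (-1) (by simp) (by simp)
    rw [neg_mul_neg, mul_one, q_one] at this; linarith
  have := D.mul (-1) x (by simp) hx
  rw [neg_one_mul] at this; linarith

lemma q_inv {x : L} (hx : x ≠ 0) : D.q x⁻¹ = - D.q x := by
  have := D.mul x x⁻¹ hx (inv_ne_zero hx)
  rw [mul_inv_cancel₀ hx, q_one] at this; linarith

lemma q_div {x y : L} (hx : x ≠ 0) (hy : y ≠ 0) : D.q (x / y) = D.q x - D.q y := by
  rw [div_eq_mul_inv, D.mul _ _ hx (inv_ne_zero hy), q_inv hy]; ring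

lemma q_pow {x : L} (hx : x ≠ 0) (n : ℕ) : D.q (x ^ n) = n * D.q x := by
  induction n with
  | zero => simp [q_one]
  | succ n ih => rw [pow_succ, D.mul _ _ (pow_ne_zero _ hx) hx, ih]; push_cast; ring

lemma q_zpow {x : L} (hx : x ≠ 0) (n : ℤ) : D.q (x ^ n) = n * D.q x := by
  obtain ⟨k, rfl | rfl⟩ := n.eq_nat_or_neg
  · rw [zpow_natCast, q_pow hx]; simp
  · rw [zpow_neg, zpow_natCast, q_inv (pow_ne_zero _ hx), q_pow hx]; simp

lemma q_prod {ι : Type*} (s : Finset ι) (f : ι → L) (hf : ∀ i ∈ s, f i ≠ 0) :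
    D.q (∏ i ∈ s, f i) = ∑ i ∈ s, D.q (f i) := by
  classical
  induction s using Finset.induction_on with
  | empty => simp [q_one]
  | insert a s ha ih =>
    rw [Finset.prod_insert ha, Finset.sum_insert ha, D.mul _ _ (hf a (by simp))
      (Finset.prod_ne_zero_iff.2 fun i hi => hf i (by simp [hi])), ih fun i hi => hf i (by simp [hi])]

lemma N_iff {x : L} (hx : x ≠ 0) : D.N x ↔ 0 ≤ D.q x := by simp [N, hx]
lemma P_iff {x : L} (hx : x ≠ 0) : D.P x ↔ 0 < D.q x := by simp [P, hx]

lemma P_N {x : L} (h : D.P x) : D.N x := h.imp id le_of_lt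

lemma N_add {x y : L} (hx : D.N x) (hy : D.N y) : D.N (x + y) := by
  rcases hx with rfl | hx
  · simpa using hy
  by_cases hx0 : x = 0
  · subst hx0; simpa using hy
  rcases hy with rfl | hy
  · simpa using (N_iff hx0).2 hx
  by_cases hy0 : y = 0
  · subst hy0; simpa using (N_iff hx0).2 hx
  by_cases h : x + y = 0
  · exact Or.inl h
  · exact Or.inr ((le_min hx hy).trans (D.add _ _ hx0 hy0 h))

lemma P_add {x y : L} (hx : D.P x) (hy : D.P y) : D.P (x + y) := by
  by_cases hx0 : x = 0
  · subst hx0; simpa using hy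
  by_cases hy0 : y = 0
  · subst hy0; simpa using hx
  by_cases h : x + y = 0
  · exact Or.inl h
  · exact Or.inr ((lt_min ((P_iff hx0).1 hx) ((P_iff hy0).1 hy)).trans_le (D.add _ _ hx0 hy0 h))

lemma N_neg {x : L} (hx : D.N x) : D.N (-x) := by
  rcases hx with rfl | hx
  · simp [N]
  · exact Or.inr (by rwa [q_neg])

lemma P_neg {x : L} (hx : D.P x) : D.P (-x) := by
  rcases hx with rfl | hx
  · simp [P]
  · exact Or.inr (by rwa [q_neg])

lemma P_sub {x y : L} (hx : D.P x) (hy : D.P y) : D.P (x - y) := by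
  rw [sub_eq_add_neg]; exact P_add hx (P_neg hy)

lemma N_mul {x y : L} (hx : D.N x) (hy : D.N y) : D.N (x * y) := by
  by_cases hx0 : x = 0
  · simp [N, hx0]
  by_cases hy0 : y = 0
  · simp [N, hy0]
  rw [N_iff hx0] at hx
  rw [N_iff hy0] at hy
  exact Or.inr (by rw [D.mul _ _ hx0 hy0]; positivity)

lemma P_mul {x y : L} (hx : D.N x) (hy : D.P y) : D.P (x * y) := by
  by_cases hx0 : x = 0
  · simp [P, hx0]
  by_cases hy0 : y = 0
  · simp [P, hy0]
  rw [N_iff hx0] at hx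
  rw [P_iff hy0] at hy
  exact Or.inr (by rw [D.mul _ _ hx0 hy0]; positivity)

lemma N_one : D.N 1 := Or.inr q_one.ge

lemma not_P_one : ¬ D.P 1 := by simp [P, q_one]

variable (D) in
def O : Subring L where
  carrier := {x | D.N x}
  mul_mem' := N_mul
  one_mem' := N_one
  add_mem' := N_add
  zero_mem' := Or.inl rfl
  neg_mem' := N_neg

variable (D) in
def m : Ideal D.O where
  carrier := {x | D.P x.1}
  add_mem' := P_add
  zero_mem' := Or.inl rfl
  smul_mem' := fun c _ hx => P_mul c.2 hx

lemma mem_m (x : D.O) : x ∈ D.m ↔ D.P x.1 := Iff.rfl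

instance m_max : D.m.IsMaximal := by
  rw [Ideal.isMaximal_iff]
  refine ⟨not_P_one, ?_⟩
  intro J x _ hx hJ
  have hx' : ¬ D.P x.1 := hx
  have h0 : x.1 ≠ 0 := fun h => hx' (Or.inl h)
  have h1 : D.q x.1 = 0 := by
    rw [P_iff h0] at hx'
    have := (N_iff h0).1 x.2
    linarith
  have h2 : D.N (x.1)⁻¹ := Or.inr (by rw [q_inv h0, h1]; simp)
  have h3 := J.mul_mem_left ⟨_, h2⟩ hJ
  convert h3
  ext
  simp [inv_mul_cancel₀ h0]

variable [hpp : Fact p.Prime]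

lemma pow_coprime_root (a : ℤ_[p]) (k : ℕ) (hk : p.Coprime k) : ∃ z : ℤ_[p], z ^ k = 1 + p * a := by
  have h1 := hensels_lemma (p := p) (F := (Polynomial.X ^ k - Polynomial.C (1 + p * a) : Polynomial ℤ_[p])) (a := 1) (by
    simp only [map_sub, map_pow, Polynomial.aeval_X, Polynomial.aeval_C, one_pow,
      Polynomial.derivative_sub, Polynomial.derivative_X_pow, Polynomial.derivative_C, sub_zero,
      map_mul, mul_one, map_natCast]
    have : ‖(k : ℤ_[p])‖ = 1 := by
      rw [← PadicInt.isUnit_iff, PadicInt.isUnit_iff]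
      exact_mod_cast (PadicInt.norm_natCast_eq_one_iff).2 hk
    rw [this]
    have e : (1 : ℤ_[p]) - (algebraMap ℤ_[p] ℤ_[p]) (1 + p * a) = - (p * a) := by simp
    rw [e, norm_neg, norm_mul]
    have h1 : ‖(p : ℤ_[p])‖ < 1 := by
      rw [PadicInt.norm_p]
      exact inv_lt_one_of_one_lt₀ (by exact_mod_cast hpp.1.one_lt)
    have h2 := PadicInt.norm_le_one a
    have h3 := norm_nonneg (p : ℤ_[p])
    have h4 := norm_nonneg a
    nlinarith)
  obtain ⟨z, hz, -⟩ := h1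
  refine ⟨z, ?_⟩
  simpa [sub_eq_zero] using hz

variable [Algebra ℚ_[p] L]

lemma padic_N (hint : ∀ x : L, x ≠ 0 → ∃ k : ℤ, D.q x = k) (a : ℤ_[p]) :
    D.N (algebraMap ℚ_[p] L a) := by
  by_contra hN
  set f := algebraMap ℚ_[p] L with hf
  have ha : f a ≠ 0 := fun h => hN (Or.inl h)
  rw [N_iff ha] at hN
  push Not at hN
  obtain ⟨k, hk⟩ := hint _ ha
  have hk0 : k < 0 := by rw [hk] at hN; exact_mod_cast hN
  have hp0 : (p : L) ≠ 0 := by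
    have := (algebraMap ℚ_[p] L).injective.ne (a₁ := (p : ℚ_[p])) (a₂ := 0)
      (by exact_mod_cast hpp.1.ne_zero)
    simpa using this
  set y : L := p * f a ^ 2 with hy
  have hy0 : y ≠ 0 := mul_ne_zero hp0 (pow_ne_zero _ ha)
  have hqy : D.q y = 1 + 2 * k := by
    rw [hy, D.mul _ _ hp0 (pow_ne_zero _ ha), D.q_p, q_pow ha, hk]; push_cast; ring
  have hqy0 : D.q y < 0 := by
    rw [hqy]
    have : (1 + 2 * k : ℤ) < 0 := by omega
    exact_mod_cast this
  set T : L := 1 + y with hT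
  have hT0 : T ≠ 0 := by
    intro h
    have : y = -1 := by linear_combination h
    rw [this, q_neg, q_one] at hqy0
    exact lt_irrefl _ hqy0
  have hqT : D.q T = D.q y := by
    apply le_antisymm
    · have := D.add T (-1) hT0 (by simp) (by simpa [hT] using hy0)
      rw [q_neg, q_one] at this
      have e : T + -1 = y := by rw [hT]; ring
      rw [e] at this
      rcases min_le_iff.1 this with h | h
      · exact h
      · linarith
    · have := D.add 1 y one_ne_zero hy0 hT0
      rw [q_one, min_eq_right hqy0.le] at this
      exact this
  -- m-th root
  set M : ℕ := p * (1 + 2 * k).natAbs + 1 with hM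
  have hcop : p.Coprime M := by
    rw [hM]; simp
  obtain ⟨z, hz⟩ := pow_coprime_root (a ^ 2) M hcop
  have hz' : f z ^ M = T := by
    have := congrArg (fun t : ℤ_[p] => f (t : ℚ_[p])) hz
    simp only [PadicInt.coe_pow, PadicInt.coe_add, PadicInt.coe_mul, PadicInt.coe_one,
      PadicInt.coe_natCast, map_pow, map_add, map_mul, map_one, map_natCast] at this
    rw [this]
  have hz0 : f z ≠ 0 := by
    intro h
    rw [h, zero_pow (by omega)] at hz'
    exact hT0 hz'.symm
  obtain ⟨l, hl⟩ := hint _ hz0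
  have h1 : ((M : ℤ) * l : ℤ) = 1 + 2 * k := by
    have := q_pow (D := D) hz0 M
    rw [hz', hqT, hqy, hl] at this
    exact_mod_cast this.symm
  have h2 : (1 + 2 * k).natAbs = M * l.natAbs := by
    rw [← h1, Int.natAbs_mul]; simp
  have h3 : (1 + 2 * k).natAbs ≠ 0 := by omega
  have h4 : l.natAbs ≠ 0 := by
    intro h; rw [h] at h2; omega
  have h5 : M ≤ (1 + 2 * k).natAbs := by
    rw [h2]; exact Nat.le_mul_of_pos_right _ (Nat.pos_of_ne_zero h4)
  have h6 : (1 + 2 * k).natAbs ≤ p * (1 + 2 * k).natAbs := Nat.le_mul_of_pos_left _ hpp.1.pos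
  omega

end QV



namespace QV
variable {p : ℕ} {L : Type} [Field L] {D : QV p L} [hpp : Fact p.Prime] [Algebra ℚ_[p] L]

lemma hP_p : D.P (p : L) := Or.inr (by rw [D.q_p]; norm_num)

noncomputable def toO (D : QV p L) (hint : ∀ x : L, x ≠ 0 → ∃ k : ℤ, D.q x = k) : ℤ_[p] →+* D.O :=
  RingHom.codRestrict ((algebraMap ℚ_[p] L).comp PadicInt.Coe.ringHom) D.O (padic_N hint)

open Polynomial in
lemma residue_alg [FiniteDimensional ℚ_[p] L] (hint : ∀ x : L, x ≠ 0 → ∃ k : ℤ, D.q x = k)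
    (c : D.O) : ∃ g : ℤ_[p][X], (g.map (PadicInt.toZMod (p := p))) ≠ 0 ∧ eval₂ (D.toO hint) c g = 0 := by
  letI : Algebra ℤ_[p] L := ((algebraMap ℚ_[p] L).comp PadicInt.Coe.ringHom).toAlgebra
  haveI : IsScalarTower ℤ_[p] ℚ_[p] L := IsScalarTower.of_algebraMap_eq (fun x => rfl)
  have h1 : IsAlgebraic ℚ_[p] c.1 := Algebra.IsAlgebraic.isAlgebraic c.1
  have h2 : IsAlgebraic ℤ_[p] c.1 := (IsFractionRing.isAlgebraic_iff ℤ_[p] ℚ_[p] L).2 h1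
  obtain ⟨f, hf, hfc⟩ := h2
  letI : NormalizedGCDMonoid ℤ_[p] := Classical.choice inferInstance
  refine ⟨f.primPart, ?_, ?_⟩
  · intro h0
    have hprim := f.isPrimitive_primPart
    have hd : (C (p : ℤ_[p])) ∣ f.primPart := by
      rw [C_dvd_iff_dvd_coeff]
      intro i
      have h3 := congrArg (fun g => g.coeff i) h0
      simp only [coeff_map, coeff_zero] at h3
      have h4 : f.primPart.coeff i ∈ RingHom.ker (PadicInt.toZMod (p := p)) := h3
      rw [PadicInt.ker_toZMod, PadicInt.maximalIdeal_eq_span_p, Ideal.mem_span_singleton] at h4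
      exact h4
    have := hprim _ hd
    exact (PadicInt.prime_p (p := p)).not_unit this
  · have e := f.eq_C_content_mul_primPart
    have hc : f.content ≠ 0 := by simpa [content_eq_zero_iff] using hf
    have h3 : aeval c.1 f.primPart = 0 := by
      rw [e, map_mul, aeval_C] at hfc
      rcases mul_eq_zero.1 hfc with h | h
      · exfalso
        apply hc
        have : algebraMap ℚ_[p] L ((f.content : ℤ_[p]) : ℚ_[p]) = 0 := h
        simpa using this
      · exact h
    have h4 : (D.O.subtype) (eval₂ (D.toO hint) c f.primPart) = 0 := by
      rw [hom_eval₂]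
      exact h3
    exact Subtype.val_injective h4

lemma perfect [FiniteDimensional ℚ_[p] L] (hint : ∀ x : L, x ≠ 0 → ∃ k : ℤ, D.q x = k) (n : ℕ)
    (c : L) (hc : D.N c) : ∃ c', D.N c' ∧ D.P (c - c' ^ p ^ n) := by
  letI : Field (D.O ⧸ D.m) := Ideal.Quotient.field D.m
  have hp0 : ((p : ℕ) : D.O ⧸ D.m) = 0 := by
    have : Ideal.Quotient.mk D.m (p : D.O) = 0 := by
      rw [Ideal.Quotient.eq_zero_iff_mem, mem_m]
      simpa using hP_p
    simpa using this
  haveI : CharP (D.O ⧸ D.m) p := by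
    refine (CharP.charP_iff_prime_eq_zero hpp.1).2 hp0
  letI : Algebra (ZMod p) (D.O ⧸ D.m) := ZMod.algebra _ p
  have hcomp : (Ideal.Quotient.mk D.m).comp (D.toO hint) =
      (algebraMap (ZMod p) (D.O ⧸ D.m)).comp (PadicInt.toZMod (p := p)) := by
    ext a
    have h1 : a - ((PadicInt.toZMod a).val : ℤ_[p]) ∈ RingHom.ker (PadicInt.toZMod (p := p)) := by
      rw [RingHom.mem_ker, map_sub, map_natCast, ZMod.natCast_val, ZMod.cast_id, sub_self]
    rw [PadicInt.ker_toZMod, PadicInt.maximalIdeal_eq_span_p, Ideal.mem_span_singleton] at h1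
    obtain ⟨b, hb⟩ := h1
    have hb' : a = ((PadicInt.toZMod a).val : ℤ_[p]) + p * b := by linear_combination hb
    have h2 := congrArg ((Ideal.Quotient.mk D.m).comp (D.toO hint)) hb'
    rw [map_add, map_mul, map_natCast, map_natCast, hp0, zero_mul, add_zero] at h2
    rw [h2, RingHom.comp_apply, ← map_natCast (algebraMap (ZMod p) (D.O ⧸ D.m)), ZMod.natCast_val,
      ZMod.cast_id]
  haveI : Algebra.IsAlgebraic (ZMod p) (D.O ⧸ D.m) := by
    constructor
    intro x
    obtain ⟨c, rfl⟩ := Ideal.Quotient.mk_surjective x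
    obtain ⟨g, hg, hgc⟩ := residue_alg hint c
    refine ⟨_, hg, ?_⟩
    rw [Polynomial.aeval_def, Polynomial.eval₂_map, ← hcomp, ← Polynomial.hom_eval₂, hgc, map_zero]
  haveI : PerfectField (D.O ⧸ D.m) := Algebra.IsAlgebraic.perfectField (K := ZMod p)
  haveI : PerfectRing (D.O ⧸ D.m) p := PerfectField.toPerfectRing p
  obtain ⟨y, hy⟩ := (bijective_iterateFrobenius (D.O ⧸ D.m) p n).2 (Ideal.Quotient.mk D.m ⟨c, hc⟩)
  obtain ⟨c', rfl⟩ := Ideal.Quotient.mk_surjective y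
  refine ⟨c'.1, c'.2, ?_⟩
  rw [iterateFrobenius_def, ← map_pow] at hy
  have := (Ideal.Quotient.eq).1 hy.symm
  rw [mem_m] at this
  simpa using this

end QV



namespace Herb

open MeasureTheory intervalIntegral

variable (g : ℤ → ℝ) (C : ℝ) (h1 : ∀ i, 0 < g i) (hl : ∃ c, 0 < c ∧ ∀ i, c ≤ g i) (hC : ∀ i, g i ≤ C)

include h1 hC in
lemma integrable (a b : ℝ) : IntervalIntegrable (fun t : ℝ => g ⌈t⌉) volume a b := by
  have hm : Measurable (fun t : ℝ => g ⌈t⌉) := measurable_from_top.comp Int.measurable_ceil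
  rw [intervalIntegrable_iff]
  refine Measure.integrableOn_of_bounded (M := C) ?_ hm.aestronglyMeasurable ?_
  · simp
  · refine Filter.Eventually.of_forall fun t => ?_
    rw [Real.norm_eq_abs, abs_of_pos (h1 _)]
    exact hC _

include h1 hC in
lemma diff (a b : ℝ) : (∫ t in (0:ℝ)..b, g ⌈t⌉) - (∫ t in (0:ℝ)..a, g ⌈t⌉) = ∫ t in a..b, g ⌈t⌉ := by
  rw [integral_interval_sub_left (integrable g C h1 hC _ _) (integrable g C h1 hC _ _)]

include h1 hC in
lemma lower (c : ℝ) (hc : ∀ i, c ≤ g i) {a b : ℝ} (hab : a ≤ b) :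
    c * (b - a) ≤ ∫ t in a..b, g ⌈t⌉ := by
  have := integral_mono_on (μ := volume) (f := fun _ => c) (g := fun t : ℝ => g ⌈t⌉) hab (by simp)
    (integrable g C h1 hC _ _) (fun x _ => hc _)
  simpa [mul_comm] using this

include h1 hC in
lemma cont : Continuous (fun u : ℝ => ∫ t in (0:ℝ)..u, g ⌈t⌉) :=
  continuous_primitive (fun a b => integrable g C h1 hC a b) 0

include h1 hl hC in
lemma surj (y : ℝ) : ∃ u : ℝ, (∫ t in (0:ℝ)..u, g ⌈t⌉) = y := by
  obtain ⟨c, hc0, hc⟩ := hl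
  have hl : ∀ {a b : ℝ}, a ≤ b → _ := fun {a b} hab => lower g C h1 hC c hc (a := a) (b := b) hab
  have key : ∀ z : ℝ, 0 ≤ z → z ≤ (∫ t in (0:ℝ)..(z / c), g ⌈t⌉) ∧
      (∫ t in (0:ℝ)..(-z / c), g ⌈t⌉) ≤ -z := by
    intro z hz
    constructor
    · have := hl (a := 0) (b := z / c) (by positivity)
      rw [sub_zero, mul_div_cancel₀ _ hc0.ne'] at this
      exact this
    · have h := hl (a := -z / c) (b := 0) (by rw [neg_div]; have : 0 ≤ z / c := by positivity
                                              linarith)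
      rw [integral_symm]
      have e : c * (0 - -z / c) = z := by field_simp; ring
      rw [e] at h
      linarith
  obtain ⟨k1, k2⟩ := key |y| (abs_nonneg y)
  exact mem_range_of_exists_le_of_exists_ge (cont g C h1 hC)
    ⟨_, k2.trans (neg_abs_le y)⟩ ⟨_, (le_abs_self y).trans k1⟩

include h1 hC in
lemma neg {u : ℝ} (hu : u < 0) (hl : ∃ c, 0 < c ∧ ∀ i, c ≤ g i) : (∫ t in (0:ℝ)..u, g ⌈t⌉) < 0 := by
  obtain ⟨c, hc0, hc⟩ := hl
  have := lower g C h1 hC c hc hu.le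
  rw [integral_symm]
  nlinarith

include h1 hC in
lemma mono {a b : ℝ} (hab : a ≤ b) : (∫ t in (0:ℝ)..a, g ⌈t⌉) ≤ (∫ t in (0:ℝ)..b, g ⌈t⌉) := by
  have := lower g C h1 hC 0 (fun i => (h1 i).le) hab
  rw [← diff g C h1 hC] at this
  linarith

include h1 hC in
lemma nat (m : ℕ) : (∫ t in (0:ℝ)..m, g ⌈t⌉) = ∑ j ∈ Finset.Icc 1 m, g (j : ℤ) := by
  induction m with
  | zero => simp
  | succ m ih =>
    rw [Finset.sum_Icc_succ_top (by omega), ← ih, ← sub_eq_iff_eq_add', diff g C h1 hC]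
    have : ∫ t in (m:ℝ)..((m + 1 : ℕ) : ℝ), g ⌈t⌉ = ∫ t in (m:ℝ)..((m + 1 : ℕ) : ℝ), g ((m + 1 : ℕ) : ℤ) := by
      apply intervalIntegral.integral_congr_ae
      refine Filter.Eventually.of_forall fun t ht => ?_
      rw [Set.uIoc_of_le (by simp)] at ht
      congr 1
      rw [Int.ceil_eq_iff]
      push_cast at ht ⊢
      constructor
      · linarith [ht.1]
      · exact ht.2
    rw [this]
    simp

end Herb

section
variable {p : ℕ} {A : Type} [Field A] (vd : PadicValData A p) (K L : Type) [Field K] [Field L]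
    [Algebra K L] [FiniteDimensional K L] (emb : L →+* A)

lemma herb_facts (hone : ∀ i, (1 : L ≃ₐ[K] L) ∈ lowerRamSet vd K L emb i)
     :
    (∀ i : ℕ, 0 ≤ herbrandPsi vd K L emb i) ∧
    ∀ i : ℕ, i * Nat.card (lowerRamSet vd K L emb 0) ≤
      ∑ j ∈ Finset.Icc 1 ⌈herbrandPsi vd K L emb i⌉.toNat, Nat.card (lowerRamSet vd K L emb j) := by
  have hpos : ∀ i, 0 < Nat.card (lowerRamSet vd K L emb i) := fun i => by
    haveI : Nonempty (lowerRamSet vd K L emb i) := ⟨⟨1, hone i⟩⟩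
    exact Nat.card_pos
  have hle : ∀ i, Nat.card (lowerRamSet vd K L emb i) ≤ Nat.card (L ≃ₐ[K] L) := fun i =>
    Nat.card_le_card_of_injective _ Subtype.val_injective
  have hp0 : (0 : ℝ) < Nat.card (lowerRamSet vd K L emb 0) := by exact_mod_cast hpos 0
  set g : ℤ → ℝ := fun i => (Nat.card ↥(lowerRamSet vd K L emb i) : ℝ) /
      (Nat.card ↥(lowerRamSet vd K L emb 0) : ℝ) with hg
  have hphi : ∀ u, herbrandPhi vd K L emb u = ∫ t in (0:ℝ)..u, g ⌈t⌉ := fun u => rfl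
  have h1 : ∀ i, 0 < g i := fun i => div_pos (by exact_mod_cast hpos i) hp0
  have hl : ∃ c, 0 < c ∧ ∀ i, c ≤ g i := by
    refine ⟨1 / (Nat.card ↥(lowerRamSet vd K L emb 0) : ℝ), by positivity, fun i => ?_⟩
    simp only [hg]
    gcongr
    exact_mod_cast hpos i
  have hC : ∀ i, g i ≤ (Nat.card (L ≃ₐ[K] L) : ℝ) / (Nat.card ↥(lowerRamSet vd K L emb 0) : ℝ) := by
    intro i
    simp only [hg]
    gcongr
    exact hle i
  have hpsi : ∀ y, herbrandPhi vd K L emb (herbrandPsi vd K L emb y) = y := by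
    intro y
    apply Function.invFun_eq
    exact Herb.surj g _ h1 hl hC y
  have hnn : ∀ i : ℕ, 0 ≤ herbrandPsi vd K L emb i := by
    intro i
    by_contra h
    push Not at h
    have := Herb.neg g _ h1 hC h hl
    rw [← hphi, hpsi] at this
    have : (0 : ℝ) ≤ i := by positivity
    linarith
  refine ⟨hnn, fun i => ?_⟩
  have h2 : (i : ℝ) ≤ herbrandPhi vd K L emb (⌈herbrandPsi vd K L emb i⌉.toNat : ℝ) := by
    nth_rewrite 1 [← hpsi i]
    rw [hphi, hphi]
    apply Herb.mono g _ h1 hC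
    refine (Int.le_ceil _).trans ?_
    exact_mod_cast Int.self_le_toNat _
  rw [hphi, Herb.nat g _ h1 hC] at h2
  simp only [hg] at h2
  rw [← Finset.sum_div, le_div_iff₀ hp0] at h2
  exact_mod_cast h2

end



namespace DV

variable {K L : Type} [Field K] [Field L] [Algebra K L] [FiniteDimensional K L] [IsGalois K L]
  {D : DV L}

lemma choose_aux {p : ℕ} (hpp : p.Prime) (n : ℕ) :
    ((p - 1) * p ^ n).choose (p ^ n) ≡ p - 1 [MOD p] := by
  haveI : Fact p.Prime := ⟨hpp⟩
  induction n with
  | zero => simp [Nat.ModEq.refl]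
  | succ n ih =>
    have := Choose.choose_modEq_choose_mod_mul_choose_div_nat (p := p)
      (n := (p - 1) * p ^ (n + 1)) (k := p ^ (n + 1))
    have e1 : (p - 1) * p ^ (n + 1) = (p - 1) * p ^ n * p := by ring
    rw [e1, pow_succ, Nat.mul_mod_left, Nat.mul_mod_left, Nat.mul_div_cancel _ hpp.pos,
      Nat.mul_div_cancel _ hpp.pos] at this
    rw [e1, pow_succ]
    refine this.trans ?_
    simpa using ih

lemma pow_sub {p : ℕ} (hpp : p.Prime) (hp : Odd p) (hpM : D.M 1 (p : L)) (i : ℕ) {u v : L}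
    (hu : D.M 0 u) (hv : D.M 0 v) (h : D.M 1 (u ^ p ^ i - v ^ p ^ i)) : D.M 1 (u - v) := by
  have hu' : u ∈ D.O := hu
  have hv' : v ∈ D.O := hv
  obtain ⟨r, hr⟩ := exists_add_pow_prime_pow_eq hpp (⟨u, hu'⟩ : D.O) (-⟨v, hv'⟩) i
  have hr' := congrArg (Subtype.val : D.O → L) hr
  push_cast at hr'
  rw [(hp.pow (n := i)).neg_pow] at hr'
  have hrM : D.M 0 r.1 := r.2
  have h1 : D.M 1 ((u + -v) ^ p ^ i) := by
    rw [hr']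
    refine M_add (by simpa [sub_eq_add_neg] using h) ?_
    have := M_neg (M_mul (M_mul (M_mul hpM hu) hv) hrM)
    simpa using this
  rw [← sub_eq_add_neg] at h1
  by_cases h0 : u - v = 0
  · exact Or.inl h0
  · rw [M_iff (pow_ne_zero _ h0), w_pow h0] at h1
    rw [M_iff h0]
    by_contra hlt
    have h3 : (0 : ℤ) ≤ ((p ^ i : ℕ) : ℤ) := by positivity
    nlinarith

lemma hinvM (hinv : ∀ (σ : L ≃ₐ[K] L) (x : L), x ≠ 0 → D.w (σ x) = D.w x) (σ : L ≃ₐ[K] L) {j : ℤ} {x : L}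
    (h : D.M j x) : D.M j (σ x) := by
  rcases h with rfl | h
  · simpa using M_zero j
  by_cases h0 : x = 0
  · simpa [h0] using M_zero j
  · exact Or.inr (by rwa [hinv σ x h0])

open Classical in
lemma hres_thm {p : ℕ} (hpp : p.Prime) (hp : Odd p)
    (hinv : ∀ (σ : L ≃ₐ[K] L) (x : L), x ≠ 0 → D.w (σ x) = D.w x)
    (hpM : D.M 1 (p : L)) (n : ℕ)
    (h0 : ∀ σ : L ≃ₐ[K] L, σ ∈ Gr hinv 0)
    (hcG : Nat.card (L ≃ₐ[K] L) = (p - 1) * p ^ n)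
    (hperf : ∀ c : K, D.M 0 (algebraMap K L c) → ∃ c' : K, D.M 0 (algebraMap K L c') ∧
      D.M 1 (algebraMap K L (c - c' ^ p ^ n)))
    (x : L) (hx : D.M 0 x) : ∃ c : K, D.M 1 (x - algebraMap K L c) := by
  have hs : ∀ σ : L ≃ₐ[K] L, D.M 0 (σ x) := fun σ => hinvM hinv σ hx
  have hs1 : ∀ σ : L ≃ₐ[K] L, D.M 1 (σ x - x) := fun σ => by simpa using h0 σ x hx
  have hp0 : ∀ S : Finset (L ≃ₐ[K] L), D.M 0 (∏ σ ∈ S, σ x) ∧ D.M 1 (∏ σ ∈ S, σ x - x ^ S.card) := by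
    intro S
    induction S using Finset.induction_on with
    | empty => exact ⟨by simpa using M_one, by simpa using M_zero 1⟩
    | insert a S ha ih =>
      rw [Finset.prod_insert ha, Finset.card_insert_of_notMem ha]
      refine ⟨by simpa using M_mul (hs a) ih.1, ?_⟩
      have e : a x * ∏ σ ∈ S, σ x - x ^ (S.card + 1) =
        (a x - x) * (∏ σ ∈ S, σ x) + x * (∏ σ ∈ S, σ x - x ^ S.card) := by ring
      rw [e]
      refine M_add ?_ ?_
      · simpa using M_mul (hs1 a) ih.1
      · simpa using M_mul hx ih.2
  set e : L := ∑ S ∈ Finset.powersetCard (p ^ n) (Finset.univ : Finset (L ≃ₐ[K] L)), ∏ σ ∈ S, σ x with he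
  have he0 : D.M 0 e := M_sum _ _ fun S _ => (hp0 S).1
  have he1 : D.M 1 (e - ((p - 1) * p ^ n).choose (p ^ n) * x ^ p ^ n) := by
    have h1 : D.M 1 (∑ S ∈ Finset.powersetCard (p ^ n) (Finset.univ : Finset (L ≃ₐ[K] L)),
        (∏ σ ∈ S, σ x - x ^ p ^ n)) := by
      refine M_sum _ _ fun S hS => ?_
      have := (hp0 S).2
      rwa [(Finset.mem_powersetCard.1 hS).2] at this
    rw [Finset.sum_sub_distrib, Finset.sum_const, Finset.card_powersetCard, Finset.card_univ,
      ← Nat.card_eq_fintype_card, hcG, nsmul_eq_mul] at h1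
    exact h1
  have he2 : D.M 1 (e + x ^ p ^ n) := by
    have hd : p ∣ ((p - 1) * p ^ n).choose (p ^ n) + 1 := by
      have h := (choose_aux hpp n).add_right 1
      rw [Nat.sub_add_cancel hpp.one_le] at h
      exact (Nat.modEq_zero_iff_dvd).1 (h.trans (by simp [Nat.ModEq]))
    obtain ⟨r, hr⟩ := hd
    have hr' : ((((p - 1) * p ^ n).choose (p ^ n) : ℕ) : L) + 1 = p * r := by
      simpa only [Nat.cast_add, Nat.cast_mul, Nat.cast_one] using congrArg (Nat.cast : ℕ → L) hr
    have h2 := M_add he1 (M_mul (M_mul hpM (M_natCast (D := D) r)) (M_pow hx (p ^ n)))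
    have e2 : e + x ^ p ^ n = (e - ((p - 1) * p ^ n).choose (p ^ n) * x ^ p ^ n) + p * r * x ^ p ^ n := by
      rw [← hr']; ring
    rw [e2]
    exact h2
  have hfix : ∀ τ : L ≃ₐ[K] L, τ e = e := by
    intro τ
    rw [he, map_sum]
    conv_rhs => rw [← Finset.map_univ_equiv (Equiv.mulLeft τ), Finset.powersetCard_map, Finset.sum_map]
    refine Finset.sum_congr rfl fun S _ => ?_
    rw [map_prod]
    simp [Finset.prod_map]
  obtain ⟨c0, hc0⟩ := (IsGalois.mem_range_algebraMap_iff_fixed (F := K) e).2 hfix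
  obtain ⟨c, hc, hc1⟩ := hperf (-c0) (by rw [map_neg, hc0]; exact M_neg he0)
  refine ⟨c, ?_⟩
  refine pow_sub hpp hp hpM n hx hc ?_
  have := M_add he2 hc1
  rw [map_sub, map_neg, hc0, map_pow] at this
  convert this using 1
  ring

end DV

namespace QV
variable {p : ℕ} {L : Type} [Field L] {D : QV p L}

lemma hint_of_min (hp0 : (p : L) ≠ 0) (hmin : ∀ y : L, y ≠ 0 → 0 < D.q y → 1 ≤ D.q y) (x : L) (hx : x ≠ 0) :
    ∃ k : ℤ, D.q x = k := by
  refine ⟨⌊D.q x⌋, ?_⟩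
  have hz : (p : L) ^ ⌊D.q x⌋ ≠ 0 := zpow_ne_zero _ hp0
  have h1 : D.q (x / p ^ ⌊D.q x⌋) = Int.fract (D.q x) := by
    rw [q_div hx hz, q_zpow hp0, D.q_p, mul_one]; rfl
  by_contra hne
  have h2 : 0 < Int.fract (D.q x) := by
    refine lt_of_le_of_ne (Int.fract_nonneg _) (fun h => hne ?_)
    have := Int.floor_add_fract (D.q x)
    rw [← h, add_zero] at this
    exact this.symm
  have := hmin _ (div_ne_zero hx hz) (by rw [h1]; exact h2)
  rw [h1] at this
  exact absurd (Int.fract_lt_one (D.q x)) (not_lt.2 this)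

variable {K : Type} [Field K] [Algebra K L] [FiniteDimensional K L] [IsGalois K L]

lemma q_inv_of_N (hp0 : (p : L) ≠ 0) (hN : ∀ (σ : L ≃ₐ[K] L) (x : L), D.N x → D.N (σ x))
    (σ : L ≃ₐ[K] L) (x : L) (hx : x ≠ 0) : D.q (σ x) = D.q x := by
  set b := (D.q x).den with hb
  set a := (D.q x).num with ha
  have hb0 : (b : ℚ) ≠ 0 := by exact_mod_cast (D.q x).den_nz
  have hab : (b : ℚ) * D.q x = a := by
    rw [mul_comm]; exact Rat.mul_den_eq_num _
  have hxb : x ^ b ≠ 0 := pow_ne_zero _ hx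
  have hpa : (p : L) ^ a ≠ 0 := zpow_ne_zero _ hp0
  set y := x ^ b / (p : L) ^ a with hy
  have hy0 : y ≠ 0 := div_ne_zero hxb hpa
  have hqy : D.q y = 0 := by
    rw [hy, q_div hxb hpa, q_pow hx, q_zpow hp0, D.q_p, hab]; ring
  have hsy0 : σ y ≠ 0 := by simpa using hy0
  have h1 := (N_iff hsy0).1 (hN σ y (Or.inr hqy.ge))
  have h2 := (N_iff (inv_ne_zero hsy0)).1 (by
    rw [← map_inv₀]
    exact hN σ y⁻¹ (Or.inr (by rw [q_inv hy0, hqy]; simp)))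
  rw [q_inv hsy0] at h2
  have h3 : D.q (σ y) = 0 := by linarith
  have hsx : σ x ≠ 0 := by simpa using hx
  have h4 : σ y = σ x ^ b / (p : L) ^ a := by
    rw [hy, map_div₀, map_pow, map_zpow₀, map_natCast]
  rw [h4, q_div (pow_ne_zero _ hsx) hpa, q_pow hsx, q_zpow hp0, D.q_p] at h3
  have h5 : (b : ℚ) * D.q (σ x) = b * D.q x := by linarith
  exact mul_left_cancel₀ hb0 h5

lemma exists_DV (hp0 : (p : L) ≠ 0)
    (hinv : ∀ (σ : L ≃ₐ[K] L) (x : L), x ≠ 0 → D.q (σ x) = D.q x)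
    (hint : ∀ x : K, x ≠ 0 → ∃ k : ℤ, D.q (algebraMap K L x) = k) :
    ∃ (E : DV L) (s : ℚ), 0 < s ∧ ∀ x : L, x ≠ 0 → D.q x = s * E.w x := by
  classical
  set N := Fintype.card (L ≃ₐ[K] L) with hN
  have hN0 : 0 < N := Fintype.card_pos
  have hNQ : (0 : ℚ) < N := by exact_mod_cast hN0
  have h1 : ∀ x : L, x ≠ 0 → ∃ k : ℤ, (N : ℚ) * D.q x = k := by
    intro x hx
    have hfix : ∀ τ : L ≃ₐ[K] L, τ (∏ σ : L ≃ₐ[K] L, σ x) = ∏ σ : L ≃ₐ[K] L, σ x := by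
      intro τ
      rw [map_prod]
      exact Equiv.prod_comp (Equiv.mulLeft τ) (fun σ : L ≃ₐ[K] L => σ x)
    obtain ⟨c, hc⟩ := (IsGalois.mem_range_algebraMap_iff_fixed (F := K) _).2 hfix
    have hne : ∀ σ ∈ (Finset.univ : Finset (L ≃ₐ[K] L)), σ x ≠ 0 := fun σ _ => by simpa using hx
    have hc0 : c ≠ 0 := by
      rintro rfl
      rw [map_zero] at hc
      exact Finset.prod_ne_zero_iff.2 hne hc.symm
    obtain ⟨k, hk⟩ := hint c hc0
    refine ⟨k, ?_⟩
    rw [← hk, hc, q_prod _ _ hne, Finset.sum_congr rfl (fun σ _ => hinv σ x hx)]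
    simp [hN]
  choose! f hf using h1
  have hfmul : ∀ x y, x ≠ 0 → y ≠ 0 → f (x * y) = f x + f y := by
    intro x y hx hy
    have : ((f (x * y) : ℤ) : ℚ) = f x + f y := by
      rw [← hf _ (mul_ne_zero hx hy), ← hf x hx, ← hf y hy, D.mul x y hx hy]; ring
    exact_mod_cast this
  have hfz : ∀ x, x ≠ 0 → ∀ k : ℤ, f (x ^ k) = k * f x := by
    intro x hx k
    have : ((f (x ^ k) : ℤ) : ℚ) = k * f x := by
      rw [← hf _ (zpow_ne_zero k hx), ← hf x hx, q_zpow hx]; ring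
    exact_mod_cast this
  have hex : ∃ k : ℕ, 0 < k ∧ ∃ x : L, x ≠ 0 ∧ f x = k := by
    refine ⟨N, hN0, p, hp0, ?_⟩
    have := hf _ hp0
    rw [D.q_p, mul_one] at this
    exact_mod_cast this.symm
  set t := Nat.find hex with ht
  obtain ⟨ht0, ϖ, hϖ, hϖt⟩ := Nat.find_spec hex
  have hdvd : ∀ x : L, x ≠ 0 → (t : ℤ) * (f x / t) = f x := by
    intro x hx
    have h2 := Int.emod_add_mul_ediv (f x) t
    have h3 := Int.emod_nonneg (f x) (b := (t : ℤ)) (by omega)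
    have h4 := Int.emod_lt_of_pos (f x) (b := (t : ℤ)) (by omega)
    by_contra hne
    have h5 : 0 < f x % t := by omega
    have hz := zpow_ne_zero (-(f x / t)) hϖ
    have h6 : f (x * ϖ ^ (-(f x / t))) = f x % t := by
      rw [hfmul _ _ hx hz, hfz _ hϖ, hϖt]; linarith
    have := Nat.find_min' hex (m := (f x % t).toNat) ⟨by omega, _, mul_ne_zero hx hz, by rw [h6]; omega⟩
    omega
  have htQ : (0 : ℚ) < t := by exact_mod_cast ht0
  have hq : ∀ x : L, x ≠ 0 → D.q x = (t / N : ℚ) * (f x / t : ℤ) := by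
    intro x hx
    have h2 : ((t : ℚ) * ((f x / t : ℤ) : ℚ)) = f x := by exact_mod_cast hdvd x hx
    have h3 := hf x hx
    have : (t / N : ℚ) * (f x / t : ℤ) = (t : ℚ) * ((f x / t : ℤ) : ℚ) / N := by ring
    rw [this, h2, ← h3]
    field_simp
  have hs : (0 : ℚ) < t / N := div_pos htQ hNQ
  refine ⟨⟨fun x => f x / t, ?_, ?_, ϖ, hϖ, ?_⟩, t / N, hs, hq⟩
  · intro x y hx hy
    have h2 := D.mul x y hx hy
    rw [hq _ hx, hq _ hy, hq _ (mul_ne_zero hx hy), ← mul_add] at h2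
    exact_mod_cast mul_left_cancel₀ hs.ne' h2
  · intro x y hx hy h
    have h2 := D.add x y hx hy h
    rw [hq _ hx, hq _ hy, hq _ h, ← mul_min_of_nonneg _ _ hs.le] at h2
    exact_mod_cast le_of_mul_le_mul_left h2 hs
  · show f ϖ / t = 1
    rw [hϖt]
    exact Int.ediv_self (by omega)

end QV



section
variable {p : ℕ} {A : Type} [Field A] (vd : PadicValData A p)

lemma v_coe {F : Type} [Field F] (emb : F →+* A) {x : F} (hx : x ≠ 0) :
    vd.v (emb x) = (((vd.v (emb x)).untopD 0 : ℚ) : WithTop ℚ) := by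
  have : vd.v (emb x) ≠ ⊤ := fun h => hx (by simpa using (vd.v_top_iff _).1 h)
  obtain ⟨r, hr⟩ := WithTop.ne_top_iff_exists.1 this
  rw [← hr]; rfl

noncomputable def toQV {F : Type} [Field F] (emb : F →+* A) : QV p F where
  q := fun x => (vd.v (emb x)).untopD 0
  mul := fun x y hx hy => by
    have h := vd.v_mul (emb x) (emb y)
    rw [← map_mul, v_coe vd emb hx, v_coe vd emb hy, v_coe vd emb (mul_ne_zero hx hy)] at h
    exact_mod_cast h
  add := fun x y hx hy hxy => by
    have h := vd.v_min_le_add (emb x) (emb y)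
    rw [← map_add, v_coe vd emb hx, v_coe vd emb hy, v_coe vd emb hxy] at h
    exact_mod_cast h
  q_p := by rw [map_natCast, vd.v_coe_p]; rfl

lemma v_zero : vd.v 0 = ⊤ := (vd.v_top_iff 0).2 rfl

lemma v_nonneg {F : Type} [Field F] (emb : F →+* A) (x : F) :
    0 ≤ vd.v (emb x) ↔ (toQV vd emb).N x := by
  by_cases hx : x = 0
  · simp [hx, v_zero, QV.N]
  · rw [QV.N_iff hx, v_coe vd emb hx]
    exact_mod_cast Iff.rfl

lemma v_pos {F : Type} [Field F] (emb : F →+* A) (x : F) :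
    0 < vd.v (emb x) ↔ (toQV vd emb).P x := by
  by_cases hx : x = 0
  · simp [hx, v_zero, QV.P]
  · rw [QV.P_iff hx, v_coe vd emb hx]
    exact_mod_cast Iff.rfl

lemma inMax_one {F : Type} [Field F] (emb : F →+* A) (y : F) :
    InMaxIdealPow vd emb 1 (emb y) ↔ (toQV vd emb).P y := by
  constructor
  · rintro ⟨u, s, hu, hs, h⟩
    rw [v_nonneg] at hu
    have := hs 0
    rw [v_pos] at this
    have e : y = u * s 0 := emb.injective (by rw [h]; simp)
    rw [e]
    exact QV.P_mul hu this
  · intro h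
    refine ⟨1, fun _ => y, ?_, fun _ => by rwa [v_pos], by simp⟩
    rw [v_nonneg]; exact QV.N_one

lemma inMax_nonneg {F : Type} [Field F] (emb : F →+* A) (j : ℕ) (y : F)
    (h : InMaxIdealPow vd emb j (emb y)) : (toQV vd emb).N y := by
  obtain ⟨u, s, hu, hs, h⟩ := h
  have e : y = u * ∏ k, s k := emb.injective (by rw [h, map_mul, map_prod])
  rw [e]
  refine QV.N_mul ((v_nonneg vd emb u).1 hu) ?_
  have : ∏ k, s k ∈ (toQV vd emb).O := Subring.prod_mem _ fun k _ => QV.P_N ((v_pos vd emb _).1 (hs k))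
  exact this

lemma inMax_M {F : Type} [Field F] (emb : F →+* A) (E : DV F) (s : ℚ) (hs : 0 < s)
    (hE : ∀ x : F, x ≠ 0 → (toQV vd emb).q x = s * E.w x) (j : ℕ) (y : F) :
    InMaxIdealPow vd emb j (emb y) ↔ E.M j y := by
  have hN : ∀ x, (toQV vd emb).N x ↔ E.M 0 x := by
    intro x
    by_cases hx : x = 0
    · simp [hx, QV.N, DV.M]
    · rw [QV.N_iff hx, DV.M_iff hx, hE x hx, mul_nonneg_iff_of_pos_left hs]; exact_mod_cast Iff.rfl
  have hP : ∀ x, (toQV vd emb).P x ↔ E.M 1 x := by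
    intro x
    by_cases hx : x = 0
    · simp [hx, QV.P, DV.M]
    · rw [QV.P_iff hx, DV.M_iff hx, hE x hx, mul_pos_iff_of_pos_left hs]
      rw [Int.cast_pos]; exact Iff.rfl
  constructor
  · rintro ⟨u, a, hu, ha, h⟩
    have e : y = u * ∏ k, a k := emb.injective (by rw [h, map_mul, map_prod])
    rw [v_nonneg, hN] at hu
    have key : ∀ S : Finset (Fin j), E.M (S.card : ℤ) (∏ k ∈ S, a k) := by
      intro S
      induction S using Finset.induction_on with
      | empty => simpa using DV.M_one
      | insert b S hb ih =>
        rw [Finset.prod_insert hb, Finset.card_insert_of_notMem hb]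
        have := DV.M_mul ((hP _).1 ((v_pos vd emb _).1 (ha b))) ih
        push_cast
        rwa [add_comm] at this
    have := DV.M_mul hu (key Finset.univ)
    rw [e]
    simpa using this
  · intro h
    refine ⟨y / E.t ^ j, fun _ => E.t, ?_, fun _ => ?_, ?_⟩
    · rw [v_nonneg, hN]
      by_cases hy : y = 0
      · simp [hy, DV.M]
      · rw [DV.M_iff (div_ne_zero hy (pow_ne_zero _ E.t_ne)), DV.w_div hy (pow_ne_zero _ E.t_ne),
          DV.w_pow E.t_ne, E.w_t]
        have := (DV.M_iff hy).1 h
        omega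
    · rw [v_pos, hP]; exact DV.M_t
    · simp only [Finset.prod_const, Finset.card_univ, Fintype.card_fin]
      rw [← map_pow, ← map_mul, div_mul_cancel₀ _ (pow_ne_zero _ E.t_ne)]

end

open Classical in
lemma main_aux {p : ℕ} [Fact p.Prime] (hp : Odd p)
    {A : Type} [Field A] (vd : PadicValData A p)
    (K L : Type) [Field K] [Field L]
    [Algebra ℚ_[p] K] [FiniteDimensional ℚ_[p] K]
    [Algebra K L] [FiniteDimensional K L] [IsGalois K L]
    (emb : L →+* A)
    (hab : ∀ σ τ : L ≃ₐ[K] L, σ * τ = τ * σ)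
    (hunram : IsUniformizer vd (emb.comp (algebraMap K L)) (p : K))
    (n : ℕ) (hn : 1 ≤ n) (hram : RamCond vd K L emb n) :
    ∃ (E : DV L) (s : ℚ), 0 < s ∧ (∀ x : L, x ≠ 0 → (toQV vd emb).q x = s * E.w x) ∧
      s * ((p - 1) * p ^ n : ℕ) = 1 ∧
      (∀ x, E.M (-((n + 1) * ((p - 1) * p ^ n : ℕ) - (p ^ n : ℕ))) x →
        E.M 0 (algebraMap K L (Algebra.trace K L x))) ∧
      ∃ x, x ≠ 0 ∧ E.w x = ((p - 1) * p ^ n : ℕ) - 1 - ((n + 1) * ((p - 1) * p ^ n : ℕ) - (p ^ n : ℕ)) ∧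
        Algebra.trace K L x = 1 := by
  have hpp : p.Prime := Fact.out
  obtain ⟨-, hr0, hr2, hr3, hr4, hr5⟩ := hram
  haveI : CharZero K := charZero_of_injective_algebraMap (algebraMap ℚ_[p] K).injective
  haveI : CharZero L := charZero_of_injective_algebraMap (algebraMap K L).injective
  have hpK : (p : K) ≠ 0 := by exact_mod_cast hpp.ne_zero
  have hpL : (p : L) ≠ 0 := by exact_mod_cast hpp.ne_zero
  set D := toQV vd emb with hD
  set DK := toQV vd (emb.comp (algebraMap K L)) with hDK
  have hDKq : ∀ x, DK.q x = D.q (algebraMap K L x) := fun x => rfl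
  have hint : ∀ x : K, x ≠ 0 → ∃ k : ℤ, DK.q x = k := by
    refine QV.hint_of_min hpK ?_
    intro y hy hy0
    have h1 := hunram.2.2 y ((v_pos vd _ y).2 (Or.inr hy0))
    rw [v_coe vd _ hpK, v_coe vd _ hy] at h1
    have h2 : DK.q (p : K) ≤ DK.q y := by exact_mod_cast h1
    rwa [DK.q_p] at h2
  have hone : ∀ i, (1 : L ≃ₐ[K] L) ∈ lowerRamSet vd K L emb i := by
    intro i x hx
    refine ⟨0, fun _ => (p : L), by simp [v_zero], fun _ => ?_, by simp⟩
    rw [map_natCast, vd.v_coe_p]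
    exact zero_lt_one
  obtain ⟨hpsi, hphi⟩ := herb_facts vd K L emb hone
  have hNN : ∀ (σ : L ≃ₐ[K] L) (x : L), D.N x → D.N (σ x) := by
    intro σ x hx
    have h1 : σ ∈ upperRamSet vd K L emb 0 := by rw [hr0]; trivial
    have h2 := h1 x ((v_nonneg vd emb x).2 hx)
    rw [← map_sub] at h2
    have h3 := QV.N_add (inMax_nonneg vd emb _ _ h2) hx
    simpa using h3
  have hinvq := QV.q_inv_of_N hpL hNN
  obtain ⟨E, s, hs, hE⟩ := QV.exists_DV hpL hinvq hint
  have hinv : ∀ (σ : L ≃ₐ[K] L) (x : L), x ≠ 0 → E.w (σ x) = E.w x := by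
    intro σ x hx
    have := hinvq σ x hx
    rw [hE _ hx, hE _ (by simpa using hx)] at this
    exact_mod_cast mul_left_cancel₀ hs.ne' this
  have hN : ∀ x, D.N x ↔ E.M 0 x := by
    intro x
    by_cases hx : x = 0
    · simp [hx, QV.N, DV.M]
    · rw [QV.N_iff hx, DV.M_iff hx, hE x hx, mul_nonneg_iff_of_pos_left hs]; exact_mod_cast Iff.rfl
  have hP : ∀ x, D.P x ↔ E.M 1 x := by
    intro x
    by_cases hx : x = 0
    · simp [hx, QV.P, DV.M]
    · rw [QV.P_iff hx, DV.M_iff hx, hE x hx, mul_pos_iff_of_pos_left hs]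
      rw [Int.cast_pos]; exact Iff.rfl
  have hNK : ∀ x, DK.N x ↔ D.N (algebraMap K L x) := by
    intro x; simp only [QV.N, hDKq, map_eq_zero]
  have hPK : ∀ x, DK.P x ↔ D.P (algebraMap K L x) := by
    intro x; simp only [QV.P, hDKq, map_eq_zero]
  -- lower ramification sets
  have hlow : ∀ j : ℕ, lowerRamSet vd K L emb j = (DV.Gr hinv j : Set (L ≃ₐ[K] L)) := by
    intro j
    ext σ
    have e : ((j : ℤ) + 1).toNat = j + 1 := by omega
    show (∀ x : L, 0 ≤ vd.v (emb x) → InMaxIdealPow vd emb ((j : ℤ) + 1).toNat (emb (σ x) - emb x)) ↔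
      ∀ x, E.M 0 x → E.M (j + 1) (σ x - x)
    refine forall_congr' fun x => ?_
    rw [v_nonneg, ← hN, e, ← map_sub, inMax_M vd emb E s hs hE]
    push_cast
    rfl
  have hlowc : ∀ j : ℕ, Nat.card (lowerRamSet vd K L emb j) = Nat.card (DV.Gr hinv (j : ℤ)) := by
    intro j; rw [hlow j]; rfl
  set m : ℕ → ℕ := fun i => ⌈herbrandPsi vd K L emb i⌉.toNat with hm
  have hmi : ∀ i : ℕ, ((m i : ℕ) : ℤ) = ⌈herbrandPsi vd K L emb i⌉ := by
    intro i
    exact Int.toNat_of_nonneg (Int.ceil_nonneg (hpsi i))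
  have hup : ∀ i : ℕ, upperRamSet vd K L emb (i : ℤ) = (DV.Gr hinv (m i : ℤ) : Set (L ≃ₐ[K] L)) := by
    intro i
    rw [← hlow (m i), hmi, upperRamSet]
    simp
  have hupc : ∀ i : ℕ, Nat.card (upperRamSet vd K L emb (i : ℤ)) = Nat.card (DV.Gr hinv (m i : ℤ)) := by
    intro i; rw [hup i]; rfl
  have h0 : ∀ σ : L ≃ₐ[K] L, σ ∈ DV.Gr hinv 0 := by
    intro σ
    have h1 : σ ∈ upperRamSet vd K L emb ((0 : ℕ) : ℤ) := by
      rw [Nat.cast_zero, hr0]; trivial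
    rw [hup] at h1
    exact DV.Gr_anti hinv (by omega) h1
  have hcard : ∀ i, 1 ≤ i → i ≤ n + 1 → Nat.card (DV.Gr hinv (m i)) = p ^ (n + 1 - i) := by
    have key : ∀ k, k ≤ n → Nat.card (DV.Gr hinv (m (n + 1 - k))) = p ^ k := by
      intro k
      induction k with
      | zero =>
        intro _
        rw [Nat.sub_zero, ← hupc, Nat.cast_succ, hr5]
        simp
      | succ k ih =>
        intro hk
        have h1 := hr4 (n + 1 - (k + 1)) (by omega) (by omega)
        have e : ((n + 1 - (k + 1) : ℕ) : ℤ) + 1 = ((n + 1 - k : ℕ) : ℤ) := by omega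
        rw [e, hupc, hupc, ih (by omega)] at h1
        rw [h1]; ring
    intro i h1 h2
    have := key (n + 1 - i) (by omega)
    rwa [show n + 1 - (n + 1 - i) = i by omega] at this
  have hcG : Nat.card (L ≃ₐ[K] L) = (p - 1) * p ^ n := by
    have h1 := hr3
    have e : (1 : ℤ) = ((1 : ℕ) : ℤ) := rfl
    rw [hr0, e, hupc, hcard 1 le_rfl (by omega), Nat.card_univ] at h1
    simpa using h1
  have hnest : ∀ i, 1 ≤ i → i ≤ n → DV.Gr hinv (m (i + 1)) ≤ DV.Gr hinv (m i) := by
    intro i _ _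
    have h1 := hr2 i
    rw [← Nat.cast_succ, hup, hup] at h1
    exact h1
  have hG0 : Nat.card (lowerRamSet vd K L emb 0) = (p - 1) * p ^ n := by
    have h1 := hlowc 0
    have h2 : DV.Gr hinv 0 = ⊤ := by
      rw [eq_top_iff]; exact fun σ _ => h0 σ
    rw [Nat.cast_zero, h2] at h1
    rw [h1, ← hcG]
    exact Nat.card_congr Subgroup.topEquiv.toEquiv
  have hphi' : n * ((p - 1) * p ^ n) ≤ ∑ j ∈ Finset.Icc 1 (m n), Nat.card (DV.Gr hinv (j : ℤ)) := by
    have h1 := hphi n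
    rw [hG0] at h1
    refine h1.trans (le_of_eq (Finset.sum_congr rfl fun j _ => hlowc j))
  have hpM : E.M 1 (p : L) := (hP _).1 (Or.inr (by rw [D.q_p]; norm_num))
  have hperf : ∀ c : K, E.M 0 (algebraMap K L c) → ∃ c' : K, E.M 0 (algebraMap K L c') ∧
      E.M 1 (algebraMap K L (c - c' ^ p ^ n)) := by
    intro c hc
    obtain ⟨c', h1, h2⟩ := QV.perfect hint n c ((hNK c).2 ((hN _).2 hc))
    exact ⟨c', (hN _).1 ((hNK _).1 h1), (hP _).1 ((hPK _).1 h2)⟩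
  have hres := DV.hres_thm hpp hp hinv hpM n h0 hcG hperf
  have hwp1 : 1 ≤ E.w (p : L) := (DV.M_iff hpL).1 hpM
  have hF : ∃ c : K, c ≠ 0 ∧ 0 < E.w (algebraMap K L c) :=
    ⟨(p : K), hpK, by rw [map_natCast]; omega⟩
  have hfr : Module.finrank K L = (p - 1) * p ^ n := by
    rw [← IsGalois.card_aut_eq_finrank, hcG]
  have hwp : E.w (p : L) = ((p - 1) * p ^ n : ℕ) := by
    obtain ⟨⟨c, hc0, hc⟩, h2, -⟩ := DV.structure_thm hinv hres hF
    have hcL : algebraMap K L c ≠ 0 := by simpa using hc0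
    rw [hfr] at hc h2
    have hNpos : 0 < (p - 1) * p ^ n :=
      Nat.mul_pos (by have := hpp.two_le; omega) (pow_pos hpp.pos _)
    apply le_antisymm
    · obtain ⟨k, hk⟩ := hint c hc0
      have h3 : D.q (algebraMap K L c) = s * E.w (algebraMap K L c) := hE _ hcL
      have h4 : D.q (p : L) = s * E.w (p : L) := hE _ hpL
      rw [D.q_p] at h4
      rw [hDKq] at hk
      rw [hk, hc] at h3
      have hNQ : (0 : ℚ) < (((p - 1) * p ^ n : ℕ) : ℤ) := by exact_mod_cast hNpos
      have h5 : (0 : ℚ) < k := by rw [h3]; exact mul_pos hs hNQ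
      have h6 : (1 : ℤ) ≤ k := by
        have : (0 : ℤ) < k := by exact_mod_cast h5
        omega
      have h7 : (1 : ℚ) ≤ k := by exact_mod_cast h6
      rw [h3, h4] at h7
      exact_mod_cast le_of_mul_le_mul_left h7 hs
    · have h3 := h2 (p : K) hpK
      rw [map_natCast] at h3
      exact Int.le_of_dvd (by omega) h3
  have hdd := DV.ram_thm hpp hp hinv hres hab h0 n hn hwp hcG m hcard hnest hphi'
  have htr := DV.trace_thm hinv hres hF ((n + 1) * ((p - 1) * p ^ n : ℕ) - (p ^ n : ℕ)) (by
    rw [← hdd, DV.dd]; simp)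
  refine ⟨E, s, hs, hE, ?_, htr.1, ?_⟩
  · have h4 : D.q (p : L) = s * E.w (p : L) := hE _ hpL
    rw [D.q_p, hwp] at h4
    exact_mod_cast h4.symm
  · obtain ⟨x, h1, h2, h3⟩ := htr.2
    rw [hfr] at h2
    exact ⟨x, h1, h2, h3⟩

section

/-- Lemma 2.9 / "non-degenerate pairing". Let `L/K` satisfy condition
(ram) with parameter `n ≥ 1` and `K` unramified over `ℚ_p`.  Put
`M_1 := O_L·m_1 = m_L^{p^n}` and `V := O_L/M_1`.  For `β ∈ O_L` let
`f_β : O_L → k`, `x ↦ π^{−n}·Tr_{L/K}(βx) mod π` (`k` the residue field of `K`; we state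
`f_β x = 0` in `k` as `π^{-n} Tr_{L/K}(βx) ∈ m_K`).  Then: `f_β` takes values in `O_K`
and factors through `V`; `f_β` is identically zero iff `β ∈ M_1`; and the induced
pairing `V × V → k`, `(x,y) ↦ π^{−n}·Tr_{L/K}(xy) mod π`, is non-degenerate (in each
variable, by symmetry of the trace pairing). -/
theorem statement10 {p : ℕ} [Fact p.Prime] (hp : Odd p)
    {A : Type} [Field A] (vd : PadicValData A p)
    (K L : Type) [Field K] [Field L]
    [Algebra ℚ_[p] K] [FiniteDimensional ℚ_[p] K]
    [Algebra K L] [FiniteDimensional K L] [IsGalois K L]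
    (emb : L →+* A)
    (hab : ∀ σ τ : L ≃ₐ[K] L, σ * τ = τ * σ)
    (π : K) (hπ : IsUniformizer vd (emb.comp (algebraMap K L)) π)
    (hunram : IsUniformizer vd (emb.comp (algebraMap K L)) (p : K))
    (n : ℕ) (hn : 1 ≤ n) (hram : RamCond vd K L emb n)
    (β : L) (hβ : 0 ≤ vd.v (emb β)) :
    -- `f_β` takes values in `O_K`
    (∀ x : L, 0 ≤ vd.v (emb x) →
      0 ≤ vd.v ((emb.comp (algebraMap K L)) (Algebra.trace K L (β * x) / π ^ n))) ∧
    -- `f_β` factors through `V = O_L/M_1`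
    (∀ x y : L, 0 ≤ vd.v (emb x) → 0 ≤ vd.v (emb y) →
      InMaxIdealPow vd emb (p ^ n) (emb x - emb y) →
      InMaxIdealPow vd (emb.comp (algebraMap K L)) 1
        ((emb.comp (algebraMap K L))
          (Algebra.trace K L (β * x) / π ^ n - Algebra.trace K L (β * y) / π ^ n))) ∧
    -- `f_β ≡ 0` iff `β ∈ M_1 = m_L^{p^n}`
    ((∀ x : L, 0 ≤ vd.v (emb x) →
        InMaxIdealPow vd (emb.comp (algebraMap K L)) 1
          ((emb.comp (algebraMap K L)) (Algebra.trace K L (β * x) / π ^ n)))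
      ↔ InMaxIdealPow vd emb (p ^ n) (emb β)) ∧
    -- non-degeneracy of the induced pairing on `V`
    (∀ x : L, 0 ≤ vd.v (emb x) →
      (∀ y : L, 0 ≤ vd.v (emb y) →
        InMaxIdealPow vd (emb.comp (algebraMap K L)) 1
          ((emb.comp (algebraMap K L)) (Algebra.trace K L (x * y) / π ^ n))) →
      InMaxIdealPow vd emb (p ^ n) (emb x)) ∧
    (∀ y : L, 0 ≤ vd.v (emb y) →
      (∀ x : L, 0 ≤ vd.v (emb x) →
        InMaxIdealPow vd (emb.comp (algebraMap K L)) 1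
          ((emb.comp (algebraMap K L)) (Algebra.trace K L (x * y) / π ^ n))) →
      InMaxIdealPow vd emb (p ^ n) (emb y)) := by
  have hpp : p.Prime := Fact.out
  have hCK : CharZero K := charZero_of_injective_algebraMap (algebraMap ℚ_[p] K).injective
  have hpK : (p : K) ≠ 0 := by exact_mod_cast hpp.ne_zero
  obtain ⟨E, s, hs, hE, hsN, htr, z, hz0, hz, htz⟩ := main_aux hp vd K L emb hab hunram n hn hram
  set e : ℤ := (((p - 1) * p ^ n : ℕ) : ℤ) with he
  set P : ℤ := ((p ^ n : ℕ) : ℤ) with hP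
  have hP0 : 0 < P := by rw [hP]; exact_mod_cast pow_pos hpp.pos n
  have heP : P ≤ e := by
    rw [hP, he]
    have : p ^ n ≤ (p - 1) * p ^ n := Nat.le_mul_of_pos_left _ (by have := hpp.two_le; omega)
    exact_mod_cast this
  have hπ0 : π ≠ 0 := hπ.1
  set ϖ : L := algebraMap K L π with hϖ
  have hϖ0 : ϖ ≠ 0 := by simpa [hϖ] using hπ0
  have hN : ∀ x : L, 0 ≤ vd.v (emb x) ↔ E.M 0 x := by
    intro x
    rw [v_nonneg]
    by_cases hx : x = 0
    · simp [hx, QV.N, DV.M]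
    · rw [QV.N_iff hx, DV.M_iff hx, hE x hx, mul_nonneg_iff_of_pos_left hs]; exact_mod_cast Iff.rfl
  have hPP : ∀ x : L, 0 < vd.v (emb x) ↔ E.M 1 x := by
    intro x
    rw [v_pos]
    by_cases hx : x = 0
    · simp [hx, QV.P, DV.M]
    · rw [QV.P_iff hx, DV.M_iff hx, hE x hx, mul_pos_iff_of_pos_left hs]
      rw [Int.cast_pos]; exact Iff.rfl
  have hwϖ : E.w ϖ = e := by
    have h1 := hunram.2.2 π hπ.2.1
    have h2 := hπ.2.2 (p : K) hunram.2.1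
    have h3 : vd.v ((emb.comp (algebraMap K L)) π) = vd.v ((emb.comp (algebraMap K L)) (p : K)) :=
      le_antisymm h2 h1
    rw [map_natCast, vd.v_coe_p, v_coe vd _ hπ0] at h3
    have h4 : (toQV vd (emb.comp (algebraMap K L))).q π = 1 := by exact_mod_cast h3
    have h5 : (toQV vd emb).q ϖ = 1 := h4
    rw [hE _ hϖ0, ← hsN] at h5
    exact_mod_cast mul_left_cancel₀ hs.ne' h5
  have hone : ∀ y : K, InMaxIdealPow vd (emb.comp (algebraMap K L)) 1
      ((emb.comp (algebraMap K L)) y) ↔ E.M 1 (algebraMap K L y) := by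
    intro y
    rw [inMax_one, ← v_pos, ← hPP]; rfl
  have htrd : ∀ (x : L) (k : ℕ), Algebra.trace K L x / π ^ k = Algebra.trace K L (x / ϖ ^ k) := by
    intro x k
    have : x / ϖ ^ k = (π ^ k)⁻¹ • x := by
      rw [Algebra.smul_def, map_inv₀, map_pow, div_eq_mul_inv, mul_comm]
    rw [this, map_smul, smul_eq_mul, div_eq_mul_inv, mul_comm]
  have hdivM : ∀ (x : L) (j : ℤ) (k : ℕ), E.M j x → E.M (j - k * e) (x / ϖ ^ k) := by
    intro x j k hx
    by_cases h0 : x = 0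
    · simp [h0, DV.M]
    · rw [DV.M_iff (div_ne_zero h0 (pow_ne_zero _ hϖ0)), DV.w_div h0 (pow_ne_zero _ hϖ0),
        DV.w_pow hϖ0, hwϖ]
      have := (DV.M_iff h0).1 hx
      omega
  -- trace of elements of `m^P` is divisible
  have hA : ∀ x : L, E.M P x → E.M 1 (algebraMap K L (Algebra.trace K L x / π ^ n)) := by
    intro x hx
    have h1 := htr _ (by
      have := hdivM x P (n + 1) hx
      refine DV.M_mono (le_of_eq ?_) this
      push_cast; ring)
    rw [← htrd, pow_succ, ← div_div, map_div₀] at h1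
    have h2 := DV.M_mul h1 (DV.M_w (D := E) ϖ)
    rw [hϖ, div_mul_cancel₀ _ hϖ0] at h2
    refine DV.M_mono ?_ h2
    rw [← hϖ, hwϖ]; omega
  have hB : ∀ b : L, 0 ≤ vd.v (emb b) → (∀ x : L, 0 ≤ vd.v (emb x) →
        InMaxIdealPow vd (emb.comp (algebraMap K L)) 1
          ((emb.comp (algebraMap K L)) (Algebra.trace K L (b * x) / π ^ n))) →
        InMaxIdealPow vd emb (p ^ n) (emb b) := by
    intro b hb h
    rw [inMax_M vd emb E s hs hE]
    by_contra hcon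
    have hb0 : b ≠ 0 := fun h => hcon (Or.inl h)
    rw [DV.M_iff hb0, ← hP] at hcon
    have hx0 : ϖ ^ n * z ≠ 0 := mul_ne_zero (pow_ne_zero _ hϖ0) hz0
    have h1 := h (ϖ ^ n * z / b) (by
      rw [hN, DV.M_iff (div_ne_zero hx0 hb0), DV.w_div hx0 hb0, E.mul _ _ (pow_ne_zero _ hϖ0) hz0,
        DV.w_pow hϖ0, hwϖ, hz]
      have : ((n : ℤ) + 1) * e = n * e + e := by ring
      omega)
    rw [hone, mul_div_cancel₀ _ hb0, htrd, mul_div_cancel_left₀ _ (pow_ne_zero _ hϖ0), htz, map_one,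
      DV.M_iff one_ne_zero, DV.w_one] at h1
    omega
  refine ⟨?_, ?_, ⟨hB β hβ, ?_⟩, fun x hx h => hB x hx h, fun y hy h => hB y hy fun x hx => ?_⟩
  · intro x hx
    have h1 := DV.M_mul ((hN _).1 hβ) ((hN _).1 hx)
    have h2 := htr _ (DV.M_mono (by
      have : ((n : ℤ) + 1) * e = n * e + e := by ring
      omega) (hdivM _ _ n h1))
    rw [htrd]
    exact (hN _).2 h2
  · intro x y hx hy h
    rw [← map_sub, inMax_M vd emb E s hs hE] at h
    rw [hone, ← sub_div, ← map_sub, ← mul_sub]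
    apply hA
    simpa [hP] using DV.M_mul ((hN _).1 hβ) h
  · intro h x hx
    rw [inMax_M vd emb E s hs hE] at h
    rw [hone]
    apply hA
    simpa [hP] using DV.M_mul h ((hN _).1 hx)
  · rw [mul_comm]; exact h x hx

end
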